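/- arXiv:math/0604487 — 3 statements merged into one kernel-verified Lean document; each statement's English description precedes it below -/
import Mathlib

section
/- The metric space (ℝ², Δ), where Δ(u,v) = inf_h ∫ (1+|h|²)⁻¹ ds over smooth curves h from u to v, is precompact; its completion is obtained by adding a single point at infinity, yielding a compact space. -/
/-- The metric `Δ(u,v) = inf_h ∫ (1+|h|²)⁻¹ ds`, infimum over smooth curves `h`
parametrized by arclength joining `u` and `v`. -/
noncomputable def Delta (u v : EuclideanSpace ℝ (Fin 2)) : ℝ :=
  sInf { I : ℝ | ∃ (L : ℝ) (h : ℝ → EuclideanSpace ℝ (Fin 2)),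
    0 ≤ L ∧ ContDiff ℝ (⊤ : ℕ∞) h ∧ (∀ s ∈ Set.Icc (0:ℝ) L, ‖deriv h s‖ = 1) ∧
    h 0 = u ∧ h L = v ∧ I = ∫ s in (0:ℝ)..L, (1 + ‖h s‖ ^ 2)⁻¹ }

open Set Filter Topology MeasureTheory

abbrev Pl := EuclideanSpace ℝ (Fin 2)

/-- The set of costs of admissible curves. -/
def Costs (u v : Pl) : Set ℝ := { I : ℝ | ∃ (L : ℝ) (h : ℝ → EuclideanSpace ℝ (Fin 2)),
    0 ≤ L ∧ ContDiff ℝ (⊤ : ℕ∞) h ∧ (∀ s ∈ Set.Icc (0:ℝ) L, ‖deriv h s‖ = 1) ∧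
    h 0 = u ∧ h L = v ∧ I = ∫ s in (0:ℝ)..L, (1 + ‖h s‖ ^ 2)⁻¹ }

lemma Delta_eq (u v : Pl) : Delta u v = sInf (Costs u v) := rfl

lemma rho_cont {h : ℝ → Pl} (hh : Continuous h) : Continuous fun s => (1 + ‖h s‖ ^ 2)⁻¹ := by
  refine Continuous.inv₀ (by fun_prop) (fun s => by positivity)

lemma costs_nonneg {u v : Pl} {I : ℝ} (hI : I ∈ Costs u v) : 0 ≤ I := by
  obtain ⟨L, h, hL, -, -, -, -, rfl⟩ := hI
  exact intervalIntegral.integral_nonneg hL (fun s _ => by positivity)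

lemma costs_bdd (u v : Pl) : BddBelow (Costs u v) := ⟨0, fun _ h => costs_nonneg h⟩

lemma Delta_le_of_mem {u v : Pl} {I : ℝ} (hI : I ∈ Costs u v) : Delta u v ≤ I :=
  csInf_le (costs_bdd u v) hI

lemma Delta_nonneg (u v : Pl) : 0 ≤ Delta u v := Real.sInf_nonneg (fun _ h => costs_nonneg h)

lemma Delta_line_mem (u e : Pl) (he : ‖e‖ = 1) (L : ℝ) (hL : 0 ≤ L) :
    (∫ s in (0:ℝ)..L, (1 + ‖u + s • e‖ ^ 2)⁻¹) ∈ Costs u (u + L • e) := by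
  refine ⟨L, fun s => u + s • e, hL, by fun_prop, ?_, by simp, rfl, rfl⟩
  intro s _
  have : HasDerivAt (fun s : ℝ => u + s • e) ((1:ℝ) • e) s :=
    ((hasDerivAt_id s).smul_const e).const_add u
  rw [this.deriv]; simpa using he

lemma exists_dir {u v : Pl} (h : u ≠ v) : ∃ e : Pl, ‖e‖ = 1 ∧ v - u = ‖v - u‖ • e ∧
    v = u + ‖v - u‖ • e := by
  have h0 : ‖v - u‖ ≠ 0 := by simpa [sub_eq_zero] using h.symm
  refine ⟨‖v - u‖⁻¹ • (v - u), ?_, ?_, ?_⟩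
  · rw [norm_smul]; simp [h0]
  · rw [smul_smul]; simp [h0]
  · rw [smul_smul]; simp [h0]

lemma costs_self (u : Pl) : (0:ℝ) ∈ Costs u u := by
  obtain ⟨e, he⟩ := exists_norm_eq Pl (zero_le_one' ℝ)
  simpa using Delta_line_mem u e he 0 le_rfl

lemma Delta_self (u : Pl) : Delta u u = 0 :=
  le_antisymm (Delta_le_of_mem (costs_self u)) (Delta_nonneg _ _)

lemma costs_nonempty (u v : Pl) : (Costs u v).Nonempty := by
  by_cases h : u = v
  · subst h; exact ⟨0, costs_self u⟩
  · obtain ⟨e, he, -, h2⟩ := exists_dir h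
    have := Delta_line_mem u e he ‖v - u‖ (norm_nonneg _)
    rw [← h2] at this
    exact ⟨_, this⟩

lemma Delta_le_dist (u v : Pl) : Delta u v ≤ ‖v - u‖ := by
  by_cases h : u = v
  · subst h; simp [Delta_self]
  · obtain ⟨e, he, -, h2⟩ := exists_dir h
    have := Delta_line_mem u e he ‖v - u‖ (norm_nonneg _)
    rw [← h2] at this
    refine (Delta_le_of_mem this).trans ?_
    have h3 : (∫ s in (0:ℝ)..‖v - u‖, (1 + ‖u + s • e‖ ^ 2)⁻¹) ≤ ∫ s in (0:ℝ)..‖v - u‖, (1:ℝ) := by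
      refine intervalIntegral.integral_mono_on (norm_nonneg _)
        ((rho_cont (by fun_prop)).intervalIntegrable _ _) (by simp) ?_
      intro s _
      exact inv_le_one_of_one_le₀ (by nlinarith [sq_nonneg ‖u + s • e‖])
    simpa using h3

lemma Delta_far_dir (u d : Pl) (R : ℝ) (hR : 0 < R) (hu : R ≤ ‖u‖) (hd : 0 ≤ inner ℝ u d) :
    Delta u (u + d) ≤ 2 / R := by
  by_cases h : u = u + d
  · rw [← h, Delta_self]; positivity
  · obtain ⟨e, he, h1, h2⟩ := exists_dir h
    have hm := Delta_line_mem u e he ‖u + d - u‖ (norm_nonneg _)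
    rw [← h2] at hm
    refine (Delta_le_of_mem hm).trans ?_
    simp only [add_sub_cancel_left] at *
    have hd0 : 0 < ‖d‖ := by simpa using h
    set L := ‖d‖ with hL
    have hue : 0 ≤ inner ℝ u e := by
      rw [h1, inner_smul_right] at hd
      exact nonneg_of_mul_nonneg_right hd hd0
    have hder : ∀ s ∈ uIcc 0 L, HasDerivAt (fun s : ℝ => -2 / (R + s)) (2 / (R + s) ^ 2) s := by
      intro s hs
      rw [uIcc_of_le hd0.le] at hs
      have : R + s ≠ 0 := by linarith [hs.1]
      have h6 : HasDerivAt (fun s : ℝ => -2 / (R + s)) ((0 * (R + s) - -2 * 1) / (R + s) ^ 2) s :=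
        (hasDerivAt_const s (-2:ℝ)).div ((hasDerivAt_id s).const_add R) this
      have h7 : (0 * (R + s) - -2 * 1) / (R + s) ^ 2 = 2 / (R + s) ^ 2 := by norm_num
      rwa [h7] at h6
    have hc : ContinuousOn (fun s : ℝ => 2 / (R + s) ^ 2) (uIcc 0 L) := by
      refine ContinuousOn.div (by fun_prop) (by fun_prop) ?_
      intro s hs
      rw [uIcc_of_le hd0.le] at hs
      have : 0 < R + s := by linarith [hs.1]
      positivity
    have h3 : (∫ s in (0:ℝ)..L, (1 + ‖u + s • e‖ ^ 2)⁻¹) ≤ ∫ s in (0:ℝ)..L, 2 / (R + s) ^ 2 := by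
      refine intervalIntegral.integral_mono_on hd0.le
        ((rho_cont (by fun_prop)).intervalIntegrable _ _) (hc.intervalIntegrable) ?_
      intro s hs
      have hs0 : 0 < R + s := by linarith [hs.1]
      have h4 : ‖u + s • e‖ ^ 2 = ‖u‖ ^ 2 + 2 * (s * inner ℝ u e) + s ^ 2 := by
        rw [norm_add_sq_real, inner_smul_right, norm_smul, he]; simp
      rw [inv_eq_one_div, div_le_div_iff₀ (by positivity) (by positivity), h4]
      have h5 : 0 ≤ s * inner ℝ u e := mul_nonneg hs.1 hue
      nlinarith [sq_nonneg (R - s)]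
    refine h3.trans ?_
    rw [intervalIntegral.integral_eq_sub_of_hasDerivAt hder hc.intervalIntegrable]
    have : 0 ≤ 2 / (R + L) := by positivity
    simp only [add_zero, neg_div]
    linarith

lemma Delta_symm_le (u v : Pl) : Delta v u ≤ Delta u v := by
  refine le_csInf (costs_nonempty u v) ?_
  rintro I ⟨L, h, hL, hs, hd, h0, h1, rfl⟩
  apply Delta_le_of_mem
  refine ⟨L, fun s => h (L - s), hL, by fun_prop, ?_, by simpa using h1, by simpa using h0, ?_⟩
  · intro s hsm
    rw [deriv_comp_const_sub, norm_neg]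
    exact hd _ ⟨by linarith [hsm.2], by linarith [hsm.1]⟩
  · rw [intervalIntegral.integral_comp_sub_left (fun s => (1 + ‖h s‖ ^ 2)⁻¹)]
    simp

lemma Delta_comm (u v : Pl) : Delta u v = Delta v u :=
  le_antisymm (Delta_symm_le _ _) (Delta_symm_le _ _)

lemma Delta_lower (u v : Pl) (r : ℝ) (hr : 0 ≤ r) (hrv : r ≤ ‖v - u‖) :
    r / (1 + (‖u‖ + r) ^ 2) ≤ Delta u v := by
  refine le_csInf (costs_nonempty u v) ?_
  rintro I ⟨L, h, hL, hs, hd, h0, h1, rfl⟩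
  have hb : ∀ s ∈ Icc (0:ℝ) L, ‖h s - u‖ ≤ s := by
    intro s hsm
    have := (convex_Icc (0:ℝ) L).norm_image_sub_le_of_norm_deriv_le (f := h) (C := 1)
      (fun x _ => (hs.differentiable (by simp)).differentiableAt)
      (fun x hx => (hd x hx).le) (left_mem_Icc.2 hL) hsm
    rw [h0] at this
    simpa [abs_of_nonneg hsm.1] using this
  have hrL : r ≤ L := by
    have := hb L (right_mem_Icc.2 hL)
    rw [h1] at this; linarith
  have hi : ∀ a b, IntervalIntegrable (fun s => (1 + ‖h s‖ ^ 2)⁻¹) volume a b :=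
    fun a b => (rho_cont hs.continuous).intervalIntegrable _ _
  rw [← intervalIntegral.integral_add_adjacent_intervals (hi 0 r) (hi r L)]
  have h2 : 0 ≤ ∫ s in r..L, (1 + ‖h s‖ ^ 2)⁻¹ :=
    intervalIntegral.integral_nonneg hrL (fun s _ => by positivity)
  have h3 : (∫ s in (0:ℝ)..r, (1 + (‖u‖ + r) ^ 2)⁻¹) ≤ ∫ s in (0:ℝ)..r, (1 + ‖h s‖ ^ 2)⁻¹ := by
    refine intervalIntegral.integral_mono_on hr (by simp) (hi _ _) ?_
    intro s hsm
    have h4 := hb s ⟨hsm.1, hsm.2.trans hrL⟩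
    have h5 : ‖h s‖ ≤ ‖u‖ + r := by
      have : ‖h s‖ ≤ ‖h s - u‖ + ‖u‖ := by simpa using norm_add_le (h s - u) u
      linarith [hsm.2]
    gcongr
  simp only [intervalIntegral.integral_const, sub_zero, smul_eq_mul] at h3
  rw [div_eq_mul_inv]; linarith

/-- Arclength reparametrization. -/
lemma Delta_le_regular (h : ℝ → Pl) (hs : ContDiff ℝ (⊤ : ℕ∞) h) (c : ℝ) (hc : 0 < c)
    (hd : ∀ t, c ≤ ‖deriv h t‖) :
    Delta (h 0) (h 1) ≤ ∫ t in (0:ℝ)..1, (1 + ‖h t‖ ^ 2)⁻¹ * ‖deriv h t‖ := by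
  have hds : ContDiff ℝ (⊤ : ℕ∞) (deriv h) := (contDiff_infty_iff_deriv.1 hs).2
  have hns : ContDiff ℝ (⊤ : ℕ∞) (fun t => ‖deriv h t‖) :=
    hds.norm ℝ (fun t ht => by have := hd t; rw [ht, norm_zero] at this; linarith)
  set s : ℝ → ℝ := fun t => ∫ x in (0:ℝ)..t, ‖deriv h x‖ with hsdef
  have hder : ∀ t, HasDerivAt s ‖deriv h t‖ t := fun t => hns.continuous.integral_hasStrictDerivAt 0 t |>.hasDerivAt
  have hss : ContDiff ℝ (⊤ : ℕ∞) s := by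
    refine contDiff_infty_iff_deriv.2 ⟨fun t => (hder t).differentiableAt, ?_⟩
    rw [show deriv s = fun t => ‖deriv h t‖ from funext fun t => (hder t).deriv]
    exact hns
  have hpos : ∀ t, 0 < ‖deriv h t‖ := fun t => hc.trans_le (hd t)
  have hmono : StrictMono s := strictMono_of_deriv_pos (fun t => by rw [(hder t).deriv]; exact hpos t)
  have hgrow : Monotone (fun t => s t - c * t) := by
    refine monotone_of_hasDerivAt_nonneg (f' := fun t => ‖deriv h t‖ - c * 1)
      (fun t => (hder t).sub ((hasDerivAt_id t).const_mul c)) (fun t => ?_)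
    simpa using hd t
  have hs0 : s 0 = 0 := by simp [hsdef]
  have hsurj : Function.Surjective s := by
    refine hss.continuous.surjective ?_ ?_
    · refine tendsto_atTop_mono' _ ?_ (tendsto_id.const_mul_atTop hc)
      filter_upwards [eventually_ge_atTop 0] with t ht
      have := hgrow ht
      simp [hs0] at this
      simpa using this
    · refine tendsto_atBot_mono' _ ?_ (tendsto_id.const_mul_atBot hc)
      filter_upwards [eventually_le_atBot 0] with t ht
      have := hgrow ht
      simp [hs0] at this
      simpa using this
  let e : ℝ ≃ₜ ℝ := (StrictMono.orderIsoOfSurjective s hmono hsurj).toHomeomorph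
  have he : ∀ t, e t = s t := fun t => rfl
  have hes : ContDiff ℝ (⊤ : ℕ∞) (e.symm : ℝ → ℝ) :=
    e.contDiff_symm_deriv (f' := fun t => ‖deriv h t‖) (fun t => (hpos t).ne') hder hss
  have hinv : ∀ t, e.symm (s t) = t := fun t => e.symm_apply_apply t
  have hc1 : Continuous fun x => (1 + ‖h (e.symm x)‖ ^ 2)⁻¹ :=
    rho_cont (hs.continuous.comp e.symm.continuous)
  apply Delta_le_of_mem
  refine ⟨s 1, fun x => h (e.symm x), ?_, hs.comp hes, ?_, ?_, ?_, ?_⟩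
  · rw [← hs0]; exact hmono.monotone zero_le_one
  · intro x _
    have h1 : HasDerivAt e.symm (‖deriv h (e.symm x)‖)⁻¹ x :=
      HasDerivAt.of_local_left_inverse (e.symm.continuous.continuousAt) (hder _) (hpos _).ne'
        (Eventually.of_forall fun y => e.apply_symm_apply y)
    have h2 : HasDerivAt h (deriv h (e.symm x)) (e.symm x) :=
      ((hs.differentiable (by simp)).differentiableAt).hasDerivAt
    have h3 := h2.scomp x h1
    have h4 : deriv (fun x => h (e.symm x)) x = _ := h3.deriv
    rw [h4, norm_smul, norm_inv, norm_norm, inv_mul_cancel₀ (hpos _).ne']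
  · have := hinv 0
    rw [hs0] at this
    simp only [this]
  · simp only [hinv]
  · have := intervalIntegral.integral_comp_mul_deriv (a := 0) (b := 1) (f := s)
      (f' := fun t => ‖deriv h t‖) (g := fun x => (1 + ‖h (e.symm x)‖ ^ 2)⁻¹)
      (fun t _ => hder t) hns.continuous.continuousOn hc1
    rw [hs0] at this
    rw [← this]
    simp [hinv]

lemma Delta_le_smooth (g : ℝ → Pl) (hg : ContDiff ℝ (⊤ : ℕ∞) g)
    (hout : ∀ t, t ∉ Icc (0:ℝ) 1 → deriv g t = 0) :
    Delta (g 0) (g 1) ≤ ∫ t in (0:ℝ)..1, (1 + ‖g t‖ ^ 2)⁻¹ * ‖deriv g t‖ := by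
  by_cases huw : g 0 = g 1
  · rw [← huw, Delta_self]
    exact intervalIntegral.integral_nonneg zero_le_one (fun s _ => by positivity)
  set e : Pl := g 1 - g 0 with he
  have he0 : ‖e‖ ^ 2 ≠ 0 := by
    have : e ≠ 0 := sub_ne_zero.2 (Ne.symm huw)
    positivity
  have hdg : ContDiff ℝ (⊤ : ℕ∞) (deriv g) := (contDiff_infty_iff_deriv.1 hg).2
  have hgd : ∀ t, HasDerivAt g (deriv g t) t := fun t =>
    ((hg.differentiable (by simp)).differentiableAt).hasDerivAt
  set φ : ℝ → ℝ := fun t => t - inner ℝ e (g t - g 0) / ‖e‖ ^ 2 with hφ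
  set ψ : ℝ → ℝ := fun t => 1 - inner ℝ e (deriv g t) / ‖e‖ ^ 2 with hψ
  have hφs : ContDiff ℝ (⊤ : ℕ∞) φ :=
    contDiff_id.sub ((contDiff_const.inner ℝ (hg.sub contDiff_const)).div_const _)
  have hψs : ContDiff ℝ (⊤ : ℕ∞) ψ :=
    contDiff_const.sub ((contDiff_const.inner ℝ hdg).div_const _)
  have hφd : ∀ t, HasDerivAt φ (ψ t) t := by
    intro t
    have h1 : HasDerivAt (fun t => inner ℝ e (g t - g 0)) (inner ℝ e (deriv g t)) t := by
      have := (innerSL ℝ e).hasFDerivAt.comp_hasDerivAt t ((hgd t).sub_const (g 0))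
      exact this
    exact (hasDerivAt_id t).sub (h1.div_const _)
  have hφ0 : φ 0 = 0 := by simp [hφ]
  have hφ1 : φ 1 = 0 := by
    have : inner ℝ e (g 1 - g 0) = ‖e‖ ^ 2 := by rw [← he, real_inner_self_eq_norm_sq]
    simp only [hφ, this]; rw [div_self he0]; simp
  -- the perturbed curves
  have hcd : ∀ (c : Pl) t, HasDerivAt (fun t => g t + φ t • c) (deriv g t + ψ t • c) t :=
    fun c t => (hgd t).add ((hφd t).smul_const c)
  set F : ℝ → Pl := fun t => -((ψ t)⁻¹ • deriv g t) with hF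
  set s : Set ℝ := {t | ψ t ≠ 0} with hs
  have hdense : Dense (F '' s)ᶜ := by
    apply dense_compl_of_dimH_lt_finrank
    have h1 : dimH (F '' s) ≤ dimH s := by
      apply dimH_image_le_of_locally_lipschitzOn
      intro t ht
      have hFt : ContDiffAt ℝ 1 F t := by
        refine ContDiffAt.neg (ContDiffAt.smul (ContDiffAt.inv ?_ ht) ?_)
        · exact hψs.contDiffAt.of_le (by exact_mod_cast le_top)
        · exact hdg.contDiffAt.of_le (by exact_mod_cast le_top)
      obtain ⟨K, u, hu, hK⟩ := hFt.exists_lipschitzOnWith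
      exact ⟨K, u, mem_nhdsWithin_of_mem_nhds hu, hK⟩
    have h2 : dimH s ≤ 1 := by
      refine (dimH_mono (subset_univ s)).trans ?_
      rw [Real.dimH_univ_eq_finrank]; simp
    refine (h1.trans h2).trans_lt ?_
    simp
  have hdense2 : Dense ((F '' s)ᶜ \ {0}) := hdense.sdiff_singleton 0
  set J : Pl → ℝ := fun c => ∫ t in (0:ℝ)..1, (1 + ‖g t + φ t • c‖ ^ 2)⁻¹ * ‖deriv g t + ψ t • c‖ with hJ
  have hJc : Continuous J := by
    apply intervalIntegral.continuous_parametric_intervalIntegral_of_continuous'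
    have c1 := hg.continuous
    have c2 := hdg.continuous
    have c3 := hφs.continuous
    have c4 := hψs.continuous
    refine Continuous.mul (Continuous.inv₀ (by fun_prop) (fun s => by positivity)) (by fun_prop)
  have hgood : ∀ c ∈ (F '' s)ᶜ \ {0}, Delta (g 0) (g 1) ≤ J c := by
    rintro c ⟨hc, hc0⟩
    have hc0 : c ≠ 0 := hc0
    have hne : ∀ t, deriv g t + ψ t • c ≠ 0 := by
      intro t h0
      by_cases ht : ψ t = 0
      · rw [ht, zero_smul, add_zero] at h0
        simp [hψ, h0] at ht
      · apply hc
        refine ⟨t, ht, ?_⟩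
        simp only [hF]
        rw [eq_neg_of_add_eq_zero_left h0]
        simp [smul_smul, ht]
    obtain ⟨m, hm, hmin⟩ := (isCompact_Icc (a := (0:ℝ)) (b := 1)).exists_isMinOn ⟨0, by simp⟩
      (f := fun t => ‖deriv g t + ψ t • c‖)
      ((hdg.continuous.add (hψs.continuous.smul continuous_const)).norm.continuousOn)
    have hreg := Delta_le_regular (fun t => g t + φ t • c) (hg.add (hφs.smul contDiff_const))
      (min ‖deriv g m + ψ m • c‖ ‖c‖) (lt_min (norm_pos_iff.2 (hne m)) (norm_pos_iff.2 hc0)) ?_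
    · simpa only [hφ0, hφ1, zero_smul, add_zero, (hcd c _).deriv] using hreg
    · intro t
      rw [(hcd c t).deriv]
      by_cases ht : t ∈ Icc (0:ℝ) 1
      · exact (min_le_left _ _).trans (hmin ht)
      · have h0 := hout t ht
        have : ψ t = 1 := by simp [hψ, h0]
        rw [h0, this]
        simp
  have hcl : IsClosed {c | Delta (g 0) (g 1) ≤ J c} := isClosed_le continuous_const hJc
  have h0 : (0 : Pl) ∈ {c | Delta (g 0) (g 1) ≤ J c} :=
    hcl.closure_subset_iff.2 hgood (hdense2 0)
  simpa [hJ] using h0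

lemma sT_deriv_zero {x : ℝ} (hx : x ≤ 0 ∨ 1 ≤ x) : deriv Real.smoothTransition x = 0 := by
  rcases hx with hx | hx
  · apply IsLocalMin.deriv_eq_zero
    refine Eventually.of_forall fun y => ?_
    rw [Real.smoothTransition.zero_of_nonpos hx]
    exact Real.smoothTransition.nonneg y
  · apply IsLocalMax.deriv_eq_zero
    refine Eventually.of_forall fun y => ?_
    rw [Real.smoothTransition.one_of_one_le hx]
    exact Real.smoothTransition.le_one y

lemma Delta_le_add {u v w : Pl} {I₁ I₂ : ℝ} (h₁ : I₁ ∈ Costs u v) (h₂ : I₂ ∈ Costs v w) :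
    Delta u w ≤ I₁ + I₂ := by
  obtain ⟨L₁, p, hL₁, hp, hpd, hp0, hp1, rfl⟩ := h₁
  obtain ⟨L₂, q, hL₂, hq, hqd, hq0, hq1, rfl⟩ := h₂
  set S := Real.smoothTransition with hS
  have hSs : ContDiff ℝ (⊤ : ℕ∞) S := Real.smoothTransition.contDiff
  have hSd : ∀ x, HasDerivAt S (deriv S x) x := fun t =>
    ((hSs.differentiable (by simp)).differentiableAt).hasDerivAt
  have hSn : ∀ x, 0 ≤ deriv S x := fun x => Real.smoothTransition.monotone.deriv_nonneg
  have hSc : Continuous (deriv S) := (contDiff_infty_iff_deriv.1 hSs).2.continuous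
  set a : ℝ → ℝ := fun t => L₁ * S (2 * t) with ha
  set b : ℝ → ℝ := fun t => L₂ * S (2 * t - 1) with hb
  set da : ℝ → ℝ := fun t => L₁ * (deriv S (2 * t) * 2) with hda
  set db : ℝ → ℝ := fun t => L₂ * (deriv S (2 * t - 1) * 2) with hdb
  have had : ∀ t, HasDerivAt a (da t) t := by
    intro t
    have h1 : HasDerivAt (fun t : ℝ => 2 * t) 2 t := by
      simpa using (hasDerivAt_id t).const_mul (2:ℝ)
    exact ((hSd (2 * t)).comp t h1).const_mul L₁
  have hbd : ∀ t, HasDerivAt b (db t) t := by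
    intro t
    have h1 : HasDerivAt (fun t : ℝ => 2 * t - 1) 2 t := by
      simpa using ((hasDerivAt_id t).const_mul (2:ℝ)).sub_const 1
    exact ((hSd (2 * t - 1)).comp t h1).const_mul L₂
  have has : ContDiff ℝ (⊤ : ℕ∞) a := contDiff_const.mul (hSs.comp (contDiff_const.mul contDiff_id))
  have hbs : ContDiff ℝ (⊤ : ℕ∞) b :=
    contDiff_const.mul (hSs.comp ((contDiff_const.mul contDiff_id).sub contDiff_const))
  have hdac : Continuous da := by fun_prop
  have hdbc : Continuous db := by fun_prop
  have haI : ∀ t, a t ∈ Icc 0 L₁ := fun t =>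
    ⟨mul_nonneg hL₁ (Real.smoothTransition.nonneg _),
      mul_le_of_le_one_right hL₁ (Real.smoothTransition.le_one _)⟩
  have hbI : ∀ t, b t ∈ Icc 0 L₂ := fun t =>
    ⟨mul_nonneg hL₂ (Real.smoothTransition.nonneg _),
      mul_le_of_le_one_right hL₂ (Real.smoothTransition.le_one _)⟩
  have hdan : ∀ t, 0 ≤ da t := fun t => mul_nonneg hL₁ (mul_nonneg (hSn _) (by norm_num))
  have hdbn : ∀ t, 0 ≤ db t := fun t => mul_nonneg hL₂ (mul_nonneg (hSn _) (by norm_num))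
  have hda0 : ∀ t, t ≤ 0 ∨ 1 / 2 ≤ t → da t = 0 := by
    intro t ht
    have : deriv S (2 * t) = 0 := sT_deriv_zero (by
      rcases ht with h | h
      · left; linarith
      · right; linarith)
    simp [hda, this]
  have hdb0 : ∀ t, t ≤ 1 / 2 ∨ 1 ≤ t → db t = 0 := by
    intro t ht
    have : deriv S (2 * t - 1) = 0 := sT_deriv_zero (by
      rcases ht with h | h
      · left; linarith
      · right; linarith)
    simp [hdb, this]
  have hb0 : ∀ t, t ≤ 1 / 2 → b t = 0 := by
    intro t ht
    have : S (2 * t - 1) = 0 := Real.smoothTransition.zero_of_nonpos (by linarith)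
    simp [hb, this]
  have ha1 : ∀ t, 1 / 2 ≤ t → a t = L₁ := by
    intro t ht
    have : S (2 * t) = 1 := Real.smoothTransition.one_of_one_le (by linarith)
    simp [ha, this]
  have ha0 : a 0 = 0 := by simp [ha, hS]
  have hb1 : b 1 = L₂ := by
    have : S (2 * 1 - 1) = 1 := Real.smoothTransition.one_of_one_le (by norm_num)
    show L₂ * S (2 * 1 - 1) = L₂
    rw [this, mul_one]
  have hpD : ∀ t, HasDerivAt p (deriv p t) t := fun t =>
    ((hp.differentiable (by simp)).differentiableAt).hasDerivAt
  have hqD : ∀ t, HasDerivAt q (deriv q t) t := fun t =>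
    ((hq.differentiable (by simp)).differentiableAt).hasDerivAt
  set g : ℝ → Pl := fun t => p (a t) + q (b t) - v with hg
  have hgs : ContDiff ℝ (⊤ : ℕ∞) g := ((hp.comp has).add (hq.comp hbs)).sub contDiff_const
  have hgd : ∀ t, deriv g t = da t • deriv p (a t) + db t • deriv q (b t) := by
    intro t
    exact ((((hpD (a t)).scomp t (had t)).add ((hqD (b t)).scomp t (hbd t))).sub_const v).deriv
  have hg0 : g 0 = u := by
    simp only [hg]; rw [ha0, hb0 0 (by norm_num), hp0, hq0]; simp
  have hg1 : g 1 = w := by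
    simp only [hg]; rw [hb1, ha1 1 (by norm_num), hp1, hq1]; simp
  have key := Delta_le_smooth g hgs (by
    intro t ht
    have : t < 0 ∨ 1 < t := by
      by_contra hcon
      push Not at hcon
      exact ht hcon
    rw [hgd, hda0, hdb0]
    · simp
    · rcases this with h | h
      · left; linarith
      · right; linarith
    · rcases this with h | h
      · left; linarith
      · right; linarith)
  rw [hg0, hg1] at key
  refine key.trans (le_of_eq ?_)
  have hgc : Continuous fun t => (1 + ‖g t‖ ^ 2)⁻¹ * ‖deriv g t‖ :=
    (rho_cont hgs.continuous).mul (contDiff_infty_iff_deriv.1 hgs).2.continuous.norm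
  rw [← intervalIntegral.integral_add_adjacent_intervals (b := 1 / 2)
    (hgc.intervalIntegrable _ _) (hgc.intervalIntegrable _ _)]
  congr 1
  · have := intervalIntegral.integral_comp_mul_deriv (a := 0) (b := 1 / 2) (f := a) (f' := da)
      (g := fun s => (1 + ‖p s‖ ^ 2)⁻¹) (fun t _ => had t) hdac.continuousOn (rho_cont hp.continuous)
    rw [ha0, ha1 _ le_rfl] at this
    rw [← this]
    apply intervalIntegral.integral_congr
    intro t ht
    rw [uIcc_of_le (by norm_num)] at ht
    have e1 : g t = p (a t) := by simp only [hg]; rw [hb0 t ht.2, hq0]; simp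
    have e2 : ‖deriv g t‖ = da t := by
      rw [hgd, hdb0 t (Or.inl ht.2), zero_smul, add_zero, norm_smul, hpd _ (haI t), mul_one,
        Real.norm_of_nonneg (hdan t)]
    simp only [e1, e2, Function.comp]
  · have := intervalIntegral.integral_comp_mul_deriv (a := 1 / 2) (b := 1) (f := b) (f' := db)
      (g := fun s => (1 + ‖q s‖ ^ 2)⁻¹) (fun t _ => hbd t) hdbc.continuousOn (rho_cont hq.continuous)
    rw [hb1, hb0 _ le_rfl] at this
    rw [← this]
    apply intervalIntegral.integral_congr
    intro t ht
    rw [uIcc_of_le (by norm_num)] at ht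
    have e1 : g t = q (b t) := by simp only [hg]; rw [ha1 t ht.1, hp1]; simp
    have e2 : ‖deriv g t‖ = db t := by
      rw [hgd, hda0 t (Or.inr ht.1), zero_smul, zero_add, norm_smul, hqd _ (hbI t), mul_one,
        Real.norm_of_nonneg (hdbn t)]
    simp only [e1, e2, Function.comp]

lemma Delta_triangle (u v w : Pl) : Delta u w ≤ Delta u v + Delta v w := by
  refine le_of_forall_pos_lt_add fun ε hε => ?_
  obtain ⟨I₁, h₁, l₁⟩ := exists_lt_of_csInf_lt (costs_nonempty u v)
    (show sInf (Costs u v) < Delta u v + ε / 2 by rw [← Delta_eq]; linarith)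
  obtain ⟨I₂, h₂, l₂⟩ := exists_lt_of_csInf_lt (costs_nonempty v w)
    (show sInf (Costs v w) < Delta v w + ε / 2 by rw [← Delta_eq]; linarith)
  linarith [Delta_le_add h₁ h₂]

lemma Delta_far_pos (u v : Pl) (R : ℝ) (hR : 0 < R) (hu : R ≤ ‖u‖) (hv : R ≤ ‖v‖)
    (h : 0 ≤ inner ℝ u v) : Delta u v ≤ 4 / R := by
  have h1 := Delta_far_dir u v R hR hu h
  have h2 := Delta_far_dir v u R hR hv (by rwa [real_inner_comm])
  have h3 := Delta_triangle u (u + v) v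
  rw [Delta_comm (u + v) v, add_comm u v] at h3
  rw [add_comm u v] at h1
  have : (4:ℝ) / R = 2 / R + 2 / R := by ring
  linarith

lemma Delta_far (u v : Pl) (R : ℝ) (hR : 0 < R) (hu : R ≤ ‖u‖) (hv : R ≤ ‖v‖) :
    Delta u v ≤ 8 / R := by
  obtain ⟨w, hw, h1, h2⟩ : ∃ w : Pl, ‖w‖ = ‖u‖ ∧ inner ℝ u w = 0 ∧ 0 ≤ inner ℝ w v := by
    set w : Pl := !₂[-u 1, u 0] with hw
    have hn : ‖w‖ = ‖u‖ := by
      simp [EuclideanSpace.norm_eq, hw, Fin.sum_univ_two, add_comm]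
    have hi : inner ℝ u w = 0 := by
      simp [PiLp.inner_apply, hw, Fin.sum_univ_two]; ring
    rcases le_total 0 (inner ℝ w v) with h | h
    · exact ⟨w, hn, hi, h⟩
    · exact ⟨-w, by simpa using hn, by simpa using hi, by simpa using h⟩
  have e1 := Delta_far_pos u w R hR hu (by rwa [hw]) h1.ge
  have e2 := Delta_far_pos w v R hR (by rwa [hw]) hv h2
  have e3 := Delta_triangle u w v
  have : (8:ℝ) / R = 4 / R + 4 / R := by ring
  linarith

lemma Delta_net (ε : ℝ) (hε : 0 < ε) : ∃ S : Finset Pl, ∀ u : Pl, ∃ v ∈ S, Delta u v < ε := by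
  classical
  set R : ℝ := 16 / ε with hR
  have hR0 : 0 < R := by positivity
  have h8 : 8 / R < ε := by
    have : 8 / R = ε / 2 := by rw [hR]; field_simp; norm_num
    linarith
  obtain ⟨v0, hv0⟩ := exists_norm_eq Pl hR0.le
  obtain ⟨t, ht, htf, hcov⟩ := Metric.totallyBounded_iff.1 (isCompact_closedBall (0 : Pl) R).totallyBounded ε hε |>.imp fun t h => (⟨trivial, h⟩ : True ∧ _)
  refine ⟨insert v0 htf.toFinset, fun u => ?_⟩
  by_cases hu : ‖u‖ ≤ R
  · have := hcov (show u ∈ Metric.closedBall (0:Pl) R by simpa using hu)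
    simp only [mem_iUnion, Metric.mem_ball] at this
    obtain ⟨y, hy, hd⟩ := this
    refine ⟨y, by simp [hy], ?_⟩
    refine (Delta_le_dist u y).trans_lt ?_
    rwa [← dist_eq_norm, dist_comm]
  · push Not at hu
    exact ⟨v0, by simp, (Delta_far u v0 R hR0 hu.le hv0.ge).trans_lt h8⟩

/-- A copy of the plane carrying the metric `Delta`. -/
def DPl : Type := Pl

lemma Delta_eq_zero {u v : Pl} (h : Delta u v = 0) : u = v := by
  by_contra hne
  have hp : 0 < ‖v - u‖ := norm_pos_iff.2 (sub_ne_zero.2 (Ne.symm hne))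
  have h1 := Delta_lower u v _ hp.le le_rfl
  rw [h] at h1
  have : 0 < ‖v - u‖ / (1 + (‖u‖ + ‖v - u‖) ^ 2) := by positivity
  linarith

noncomputable instance instMetricDPl : MetricSpace DPl where
  dist u v := Delta u v
  dist_self u := Delta_self u
  dist_comm u v := Delta_comm u v
  dist_triangle u v w := Delta_triangle u v w
  eq_of_dist_eq_zero := fun h => Delta_eq_zero h

lemma dist_DPl (u v : DPl) : dist u v = Delta u v := rfl

noncomputable def emb (u : Pl) : UniformSpace.Completion DPl := ((show DPl from u : DPl) : UniformSpace.Completion DPl)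

lemma dist_emb (u v : Pl) : dist (emb u) (emb v) = Delta u v :=
  UniformSpace.Completion.dist_eq (α := DPl) u v

lemma emb_dense : DenseRange emb := UniformSpace.Completion.denseRange_coe (α := DPl)

lemma emb_cont : Continuous emb := by
  refine (LipschitzWith.of_dist_le_mul (K := 1) fun u v => ?_).continuous
  rw [dist_emb, dist_comm, dist_eq_norm]
  simpa using Delta_le_dist u v

lemma compl_compact : CompactSpace (UniformSpace.Completion DPl) := by
  have htb : TotallyBounded (range emb) := by
    refine Metric.totallyBounded_iff.2 fun ε hε => ?_
    obtain ⟨S, hS⟩ := Delta_net ε hε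
    refine ⟨emb '' S, S.finite_toSet.image _, ?_⟩
    rintro _ ⟨u, rfl⟩
    obtain ⟨v, hv, hd⟩ := hS u
    simp only [mem_iUnion, Metric.mem_ball]
    exact ⟨emb v, mem_image_of_mem _ hv, by rwa [dist_emb]⟩
  have h2 := htb.closure
  rw [emb_dense.closure_range] at h2
  exact ⟨h2.isCompact_of_isClosed isClosed_univ⟩

lemma exists_infty : ∃ p : UniformSpace.Completion DPl,
    ∀ (R : ℝ) (u : Pl), 0 < R → R ≤ ‖u‖ → dist (emb u) p ≤ 8 / R := by
  choose x hx using fun n : ℕ => exists_norm_eq Pl (show (0:ℝ) ≤ n by positivity)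
  have := compl_compact
  obtain ⟨p, -, φ, hφ, hlim⟩ := isCompact_univ.tendsto_subseq (x := fun n => emb (x n)) (fun _ => mem_univ _)
  refine ⟨p, fun R u hR hu => ?_⟩
  have hl : Tendsto (fun n => dist (emb u) (emb (x (φ n)))) atTop (𝓝 (dist (emb u) p)) :=
    tendsto_const_nhds.dist hlim
  refine le_of_tendsto hl ?_
  have ht : Tendsto (fun n => ((φ n : ℕ) : ℝ)) atTop atTop :=
    tendsto_natCast_atTop_atTop.comp hφ.tendsto_atTop
  filter_upwards [ht.eventually_ge_atTop R] with n hn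
  rw [dist_emb]
  exact Delta_far _ _ R hR hu (by rw [hx]; exact hn)

lemma range_compl : ∃ p, (range emb)ᶜ = {p} := by
  obtain ⟨p, hp⟩ := exists_infty
  refine ⟨p, Subset.antisymm ?_ ?_⟩
  · intro x hx
    rw [mem_singleton_iff]
    refine eq_of_forall_dist_le fun ε hε => ?_
    set R : ℝ := 16 / ε with hR
    have hR0 : 0 < R := by positivity
    have h8 : 8 / R = ε / 2 := by rw [hR]; field_simp; norm_num
    have hK : IsClosed (emb '' Metric.closedBall (0:Pl) R) :=
      ((isCompact_closedBall (0:Pl) R).image emb_cont).isClosed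
    have hxK : x ∈ (emb '' Metric.closedBall (0:Pl) R)ᶜ := fun h => hx (image_subset_range _ _ h)
    have hopen : IsOpen ((emb '' Metric.closedBall (0:Pl) R)ᶜ ∩ Metric.ball x (ε / 2)) :=
      hK.isOpen_compl.inter Metric.isOpen_ball
    obtain ⟨u, hu1, hu2⟩ := emb_dense.exists_mem_open hopen ⟨x, hxK, by simpa using hε⟩
    have hu : R ≤ ‖u‖ := by
      by_contra hcon
      push Not at hcon
      exact hu1 ⟨u, by simpa using hcon.le, rfl⟩
    have h1 := hp R u hR0 hu
    have h2 : dist x (emb u) < ε / 2 := by rw [dist_comm]; exact hu2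
    linarith [dist_triangle x (emb u) p]
  · rintro _ rfl ⟨u, rfl⟩
    -- a far point `w` is close to `emb u`, contradiction
    set K : ℝ := 1 + (‖u‖ + 1) ^ 2 with hK
    have hK0 : 0 < K := by positivity
    obtain ⟨w, hw⟩ := exists_norm_eq Pl (show (0:ℝ) ≤ 16 * K by positivity)
    have h1 := hp (16 * K) w (by positivity) hw.ge
    rw [dist_emb, Delta_comm] at h1
    have h2 := Delta_lower u w 1 zero_le_one (by
      have := norm_sub_norm_le w u
      rw [hw] at this
      nlinarith [norm_nonneg u])
    rw [← hK] at h2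
    have h3 : 8 / (16 * K) = (1 / K) / 2 := by field_simp; norm_num
    have h4 : 0 < 1 / K := by positivity
    linarith

/-- `(ℝ², Δ)` is totally bounded (precompact), and its completion is obtained by
adding a single point at infinity, yielding a compact metric space. -/
theorem delta_precompact_one_point_completion :
    (∀ ε : ℝ, 0 < ε → ∃ S : Finset (EuclideanSpace ℝ (Fin 2)),
      ∀ u : EuclideanSpace ℝ (Fin 2), ∃ v ∈ S, Delta u v < ε) ∧
    ∃ (X : Type) (m : MetricSpace X) (f : EuclideanSpace ℝ (Fin 2) → X),
      (@CompactSpace X m.toUniformSpace.toTopologicalSpace) ∧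
      (∀ u v, m.dist (f u) (f v) = Delta u v) ∧
      (∀ x : X, ∀ ε : ℝ, 0 < ε → ∃ u, m.dist x (f u) < ε) ∧
      ∃ p : X, (Set.range f)ᶜ = {p} := by
  refine ⟨Delta_net, UniformSpace.Completion DPl, inferInstance, emb, compl_compact, dist_emb,
    ?_, range_compl⟩
  intro x ε hε
  exact emb_dense.exists_dist_lt x hε
end

section
/- Carathéodory extension theorem: a conformal map φ from the open unit disc 𝔻 onto a bounded simply connected domain G extends to a continuous map on the closed disc 𝔻̄ if and only if the boundary ∂G is locally connected. -/
section caraHelpers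
open Set Filter Topology Metric MeasureTheory

theorem cara_const_of_exp_one {S : Set ℂ} (hS : IsPreconnected S) {f : ℂ → ℂ}
    (hf : ContinuousOn f S) (h1 : ∀ x ∈ S, Complex.exp (f x) = 1) {x y : ℂ} (hx : x ∈ S)
    (hy : y ∈ S) : f x = f y := by
  have key : ∀ u v : ℂ, Complex.exp u = 1 → Complex.exp v = 1 → ‖u - v‖ < 1 → u = v := by
    intro u v hu hv huv
    have h : Complex.exp u = Complex.exp v := hu.trans hv.symm
    obtain ⟨n, hn⟩ := Complex.exp_eq_exp_iff_exists_int.1 h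
    rcases eq_or_ne n 0 with h0 | h0
    · simp [hn, h0]
    · exfalso
      have h2 : u - v = n * (2 * Real.pi * Complex.I) := by rw [hn]; ring
      rw [h2] at huv
      simp only [norm_mul, Complex.norm_intCast, Complex.norm_I, Complex.norm_ofNat,
        Complex.norm_real, Real.norm_eq_abs, abs_of_pos Real.pi_pos] at huv
      have h3 : (1 : ℝ) ≤ |(n : ℝ)| := by exact_mod_cast Int.one_le_abs h0
      nlinarith [Real.pi_gt_three]
  refine hS.induction₂' (fun a b => f a = f b) ?_ ?_ hx hy
  · intro a ha
    have := (hf a ha) (Metric.ball_mem_nhds (f a) one_pos)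
    filter_upwards [this, self_mem_nhdsWithin] with b hb hbS
    have : f b = f a := key _ _ (h1 b hbS) (h1 a ha) (by simpa [dist_eq_norm] using hb)
    exact ⟨this.symm, this⟩
  · intro a b c _ _ _ h1 h2
    exact h1.trans h2

theorem cara_const_of_exp_one_real {S : Set ℝ} (hS : IsPreconnected S) {f : ℝ → ℂ}
    (hf : ContinuousOn f S) (h1 : ∀ x ∈ S, Complex.exp (f x) = 1) {x y : ℝ} (hx : x ∈ S)
    (hy : y ∈ S) : f x = f y := by
  have hS' : IsPreconnected ((fun x : ℝ => (x : ℂ)) '' S) :=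
    hS.image _ Complex.continuous_ofReal.continuousOn
  have := cara_const_of_exp_one (f := fun z => f z.re) hS' ?_ ?_ (mem_image_of_mem _ hx)
    (mem_image_of_mem _ hy)
  · simpa using this
  · refine hf.comp Complex.continuous_re.continuousOn ?_
    rintro _ ⟨x, hx, rfl⟩
    simpa using hx
  · rintro _ ⟨x, hx, rfl⟩
    simpa using h1 x hx

theorem cara_convex_sc {S : Set ℂ} (hS : Convex ℝ S) (h : S.Nonempty) : IsSimplyConnected S := by
  have := hS.contractibleSpace h
  exact SimplyConnectedSpace.ofContractible S

theorem cara_no_nonvanishing {h : ℂ → ℂ} (hc : Continuous h) (h0 : ∀ z, h z ≠ 0) {p : ℂ} {R : ℝ}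
    (hR : 0 < R) (hh : ∀ z, R ≤ ‖z - p‖ → h z = z - p) : False := by
  have hsc : IsSimplyConnected (univ : Set ℂ) :=
    cara_convex_sc convex_univ univ_nonempty
  obtain ⟨f, hf, hfe⟩ := Complex.exists_continuousOn_eqOn_exp_comp hsc isOpen_univ
    hc.continuousOn (by simpa using h0)
  have hf' : Continuous f := continuousOn_univ.1 hf
  let F : ℝ → ℂ := fun t => f (p + R * Complex.exp (t * Complex.I)) - Real.log R - t * Complex.I
  have hF : Continuous F := by
    dsimp only [F]; fun_prop
  have hF1 : ∀ t ∈ (univ : Set ℝ), Complex.exp (F t) = 1 := by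
    intro t _
    have e1 : Complex.exp (f (p + R * Complex.exp (t * Complex.I))) =
        R * Complex.exp (t * Complex.I) := by
      have := hfe (mem_univ (p + R * Complex.exp (t * Complex.I)))
      simp only [Function.comp_apply] at this
      rw [this, hh]
      · ring
      · simp [Complex.norm_exp_ofReal_mul_I, le_abs_self]
    have hRne : (R : ℂ) ≠ 0 := by exact_mod_cast hR.ne'
    simp only [F, Complex.exp_sub, e1]
    rw [← Complex.ofReal_exp, Real.exp_log hR]
    field_simp [Complex.exp_ne_zero]
  have := cara_const_of_exp_one_real isPreconnected_univ hF.continuousOn hF1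
    (mem_univ 0) (mem_univ (2 * Real.pi))
  have h2 : (2 * Real.pi * Complex.I : ℂ) = 0 := by
    simp only [F] at this
    simp at this
    linear_combination this
  exact Complex.two_pi_I_ne_zero h2

theorem cara_log_on_compl {G : Set ℂ} (hGo : IsOpen G) (hG : IsPreconnected G) {p q : ℂ}
    (hp : p ∈ G) (hq : q ∈ G) :
    ∃ g : ℂ → ℂ, ContinuousOn g Gᶜ ∧ ∀ z ∈ Gᶜ, Complex.exp (g z) = (z - p) / (z - q) := by
  refine hG.induction₂' (fun p q => ∃ g : ℂ → ℂ, ContinuousOn g Gᶜ ∧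
    ∀ z ∈ Gᶜ, Complex.exp (g z) = (z - p) / (z - q)) ?_ ?_ hp hq
  · intro x hx
    obtain ⟨r, hr, hrG⟩ := Metric.isOpen_iff.1 hGo x hx
    have hB : ∀ᶠ y in 𝓝[G] x, y ∈ ball x r :=
      mem_nhdsWithin_of_mem_nhds (ball_mem_nhds x hr)
    have main : ∀ y ∈ ball x r, y ∈ G → ∃ g : ℂ → ℂ, ContinuousOn g Gᶜ ∧
      ∀ z ∈ Gᶜ, Complex.exp (g z) = (z - y) / (z - x) := by
      intro y hy hyG
      have hne : ∀ z ∈ Gᶜ, z - x ≠ 0 := fun z hz h => hz (by rwa [sub_eq_zero.1 h])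
      have hne' : ∀ z ∈ Gᶜ, z - y ≠ 0 := fun z hz h => hz (by rwa [sub_eq_zero.1 h])
      refine ⟨fun z => Complex.log ((z - y) / (z - x)), ?_, ?_⟩
      · refine ContinuousOn.clog (ContinuousOn.div (by fun_prop) (by fun_prop) hne) ?_
        intro z hz
        have hzr : r ≤ ‖z - x‖ := by
          by_contra hlt
          exact hz (hrG (by simpa [dist_eq_norm] using hlt))
        have e : (z - y) / (z - x) = 1 + (x - y) / (z - x) := by
          field_simp [hne z hz]; ring
        rw [e]
        apply Complex.mem_slitPlane_of_norm_lt_one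
        rw [norm_div, div_lt_one (by linarith)]
        rw [mem_ball', dist_eq_norm] at hy
        linarith
      · intro z hz
        exact Complex.exp_log (div_ne_zero (hne' z hz) (hne z hz))
    filter_upwards [hB, self_mem_nhdsWithin] with y hy hyG
    obtain ⟨g, hg, hg'⟩ := main y hy hyG
    refine ⟨⟨fun z => - g z, hg.neg, ?_⟩, g, hg, hg'⟩
    intro z hz
    rw [Complex.exp_neg, hg' z hz, inv_div]
  · rintro x y z hx hy hz ⟨g, hg, hg'⟩ ⟨k, hk, hk'⟩
    refine ⟨fun w => g w + k w, hg.add hk, ?_⟩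
    intro w hw
    have hne : w - y ≠ 0 := fun h => hw (by rwa [sub_eq_zero.1 h])
    rw [Complex.exp_add, hg' w hw, hk' w hw]
    rw [div_mul_div_cancel₀ hne]

theorem cara_separation {G U K : Set ℂ} {p q a : ℂ} {ε : ℝ} (hε : 0 < ε) (hGo : IsOpen G)
    (hG : IsPreconnected G)
    (hUb : Bornology.IsBounded U) (hUG : U ⊆ G) (hpU : p ∈ U) (hqG : q ∈ G)
    (hqU : q ∉ closure U) (hK : IsClosed K) (hKb : K ⊆ ball a ε)
    (hfr : frontier U ⊆ Gᶜ ∪ K) (hKG : IsConnected (Gᶜ ∩ K)) (hp : p ∉ ball a ε)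
    (hq : q ∉ ball a ε) : False := by
  classical
  obtain ⟨g, hg, hg'⟩ := cara_log_on_compl hGo hG (hUG hpU) hqG
  have hne : ∀ z ∈ ball a ε, z - p ≠ 0 := fun z hz h => hp (by rwa [← sub_eq_zero.1 h])
  have hne' : ∀ z ∈ ball a ε, z - q ≠ 0 := fun z hz h => hq (by rwa [← sub_eq_zero.1 h])
  obtain ⟨k, hk, hk'⟩ := Complex.exists_continuousOn_eqOn_exp_comp
    (U := ball a ε) (g := fun z => (z - p) / (z - q))
    (cara_convex_sc (convex_ball a ε) (nonempty_ball.2 hε)) isOpen_ball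
    (ContinuousOn.div (by fun_prop) (by fun_prop) hne')
    (by
      rintro ⟨z, hz, h⟩
      exact div_ne_zero (hne z hz) (hne' z hz) h)
  obtain ⟨x₀, hx₀⟩ := hKG.nonempty
  have hconst : ∀ x ∈ Gᶜ ∩ K, g x - k x = g x₀ - k x₀ := by
    intro x hx
    refine cara_const_of_exp_one (f := fun x => g x - k x) hKG.isPreconnected
      ((hg.mono inter_subset_left).sub (hk.mono (inter_subset_right.trans hKb))) ?_ hx hx₀
    intro z hz
    have h2 := hk' (hKb hz.2)
    simp only [Function.comp_apply] at h2
    rw [Complex.exp_sub, hg' z hz.1, h2]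
    exact div_self (div_ne_zero (hne z (hKb hz.2)) (hne' z (hKb hz.2)))
  let l : ℂ → ℂ := fun z => if z ∈ Gᶜ then g z else k z + (g x₀ - k x₀)
  have hl1 : EqOn l g Gᶜ := fun z hz => by simp only [l, if_pos hz]
  have hl2 : EqOn l (fun z => k z + (g x₀ - k x₀)) K := by
    intro z hz
    by_cases hzG : z ∈ Gᶜ
    · simp only [l, if_pos hzG]
      rw [← hconst z ⟨hzG, hz⟩]; ring
    · simp only [l, if_neg hzG]
  have hGc : IsClosed Gᶜ := hGo.isClosed_compl
  have hlc : ContinuousOn l (Gᶜ ∪ K) := by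
    refine ContinuousOn.union_of_isClosed (hg.congr hl1) ?_ hGc hK
    exact ((hk.mono hKb).add continuousOn_const).congr hl2
  have hx1 : Complex.exp (g x₀ - k x₀) = 1 := by
    have h2 := hk' (hKb hx₀.2)
    simp only [Function.comp_apply] at h2
    rw [Complex.exp_sub, hg' x₀ hx₀.1, h2]
    exact div_self (div_ne_zero (hne _ (hKb hx₀.2)) (hne' _ (hKb hx₀.2)))
  have hle : ∀ z ∈ Gᶜ ∪ K, Complex.exp (l z) = (z - p) / (z - q) := by
    rintro z (hz | hz)
    · rw [hl1 hz, hg' z hz]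
    · rw [hl2 hz, Complex.exp_add, hx1, mul_one]
      exact hk' (hKb hz)
  obtain ⟨m, hm⟩ := ContinuousMap.exists_restrict_eq (hGc.union hK)
    (⟨(Gᶜ ∪ K).domRestrict l, continuousOn_iff_continuous_domRestrict.mp hlc⟩ : C(_, ℂ))
  have hm' : ∀ z ∈ Gᶜ ∪ K, m z = l z := by
    intro z hz
    have := congrArg (fun F => F ⟨z, hz⟩) hm
    simpa using this
  obtain ⟨R, hR⟩ := hUb.subset_ball p
  refine cara_no_nonvanishing (h := fun z => if z ∈ U then Complex.exp (m z) * (z - q) else z - p)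
    (p := p) (R := max R 1) ?_ ?_ (by positivity) ?_
  · refine Continuous.if ?_ (by fun_prop) (by fun_prop)
    intro z hz
    have hz' := hfr hz
    rw [hm' z hz', hle z hz']
    have : z - q ≠ 0 := fun h => hqU (by
      rw [← sub_eq_zero.1 h]; exact frontier_subset_closure hz)
    field_simp
  · intro z
    split_ifs with hz
    · refine mul_ne_zero (Complex.exp_ne_zero _) fun h => hqU ?_
      rw [← sub_eq_zero.1 h]; exact subset_closure hz
    · intro h
      exact hz (by rwa [sub_eq_zero.1 h])
  · intro z hz
    have : z ∉ U := by
      intro h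
      have := hR h
      rw [mem_ball, dist_eq_norm] at this
      linarith [le_max_left R 1]
    simp only [if_neg this]


theorem cara_open_image {G : Set ℂ} {φ : ℂ → ℂ} (hφd : DifferentiableOn ℂ φ (ball 0 1))
    (hφb : BijOn φ (ball 0 1) G) {V : Set ℂ} (hV : V ⊆ ball 0 1) (hVo : IsOpen V) :
    IsOpen (φ '' V) := by
  have hA : AnalyticOnNhd ℂ φ (ball 0 1) := hφd.analyticOnNhd isOpen_ball
  rcases hA.is_constant_or_isOpen (convex_ball (0 : ℂ) 1).isPreconnected with ⟨w, hw⟩ | h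
  · exfalso
    have h0 : (0 : ℂ) ∈ ball (0 : ℂ) 1 := by simp
    have h1 : (1 / 2 : ℂ) ∈ ball (0 : ℂ) 1 := by simp; norm_num
    have := hφb.injOn h0 h1 ((hw _ h0).trans (hw _ h1).symm)
    norm_num at this
  · exact h V hV hVo

theorem cara_limit_frontier {G : Set ℂ} (hGo : IsOpen G) {φ : ℂ → ℂ}
    (hφd : DifferentiableOn ℂ φ (ball 0 1))
    (hφb : BijOn φ (ball 0 1) G) {ι : Type*} {l : Filter ι} [l.NeBot] {u : ι → ℂ} {ζ w : ℂ}
    (hu : ∀ᶠ i in l, u i ∈ ball (0 : ℂ) 1) (huζ : Tendsto u l (𝓝 ζ)) (hζ : ‖ζ‖ = 1)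
    (hw : Tendsto (fun i => φ (u i)) l (𝓝 w)) : w ∈ frontier G := by
  rw [hGo.frontier_eq]
  refine ⟨mem_closure_of_tendsto hw (hu.mono fun i hi => hφb.mapsTo hi), ?_⟩
  intro hwG
  obtain ⟨v, hv, rfl⟩ := hφb.surjOn hwG
  have hv1 : ‖v‖ < 1 := by simpa using hv
  have hVs : ball (0 : ℂ) ((1 + ‖v‖) / 2) ⊆ ball 0 1 := ball_subset_ball (by linarith)
  have hVo := cara_open_image hφd hφb hVs isOpen_ball
  have hmem : φ v ∈ φ '' ball (0 : ℂ) ((1 + ‖v‖) / 2) :=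
    mem_image_of_mem _ (by simp; linarith)
  have h1 : ∀ᶠ i in l, ‖u i‖ ≤ (1 + ‖v‖) / 2 := by
    filter_upwards [hw (hVo.mem_nhds hmem), hu] with i hi hui
    obtain ⟨x, hx, hxe⟩ := hi
    have := hφb.injOn (hVs hx) hui hxe
    rw [← this]
    exact (by simpa using hx : ‖x‖ < _).le
  have := le_of_tendsto huζ.norm h1
  linarith

theorem cara_forward (G : Set ℂ) (hGo : IsOpen G) 
    (φ : ℂ → ℂ) (hφd : DifferentiableOn ℂ φ (ball 0 1))
    (hφb : BijOn φ (ball 0 1) G) (Φ : ℂ → ℂ) (hΦ : ContinuousOn Φ (closedBall 0 1))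
    (hΦe : EqOn Φ φ (ball 0 1)) (ε : ℝ) (hε : 0 < ε) :
    ∃ δ : ℝ, 0 < δ ∧ ∀ a ∈ frontier G, ∀ b ∈ frontier G,
      dist a b < δ → ∃ B : Set ℂ, B ⊆ frontier G ∧ a ∈ B ∧ b ∈ B ∧
        IsCompact B ∧ IsConnected B ∧ diam B < ε := by
  let γ : ℝ → ℂ := fun t => Φ (Complex.exp (t * Complex.I))
  have hγ : Continuous γ := by
    refine hΦ.comp_continuous (by fun_prop) ?_
    intro t
    simp [Complex.norm_exp_ofReal_mul_I]
  have hγf : ∀ t, γ t ∈ frontier G := by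
    intro t
    let ζ := Complex.exp (t * Complex.I)
    have hζ : ‖ζ‖ = 1 := Complex.norm_exp_ofReal_mul_I t
    have hcl : ζ ∈ closure (ball (0 : ℂ) 1) := by
      rw [closure_ball _ one_ne_zero]; simp [hζ]
    have : (𝓝[ball (0 : ℂ) 1] ζ).NeBot := mem_closure_iff_nhdsWithin_neBot.1 hcl
    refine cara_limit_frontier hGo hφd hφb (l := 𝓝[ball (0 : ℂ) 1] ζ) (u := id) (ζ := ζ)
      self_mem_nhdsWithin (tendsto_id.mono_left nhdsWithin_le_nhds) hζ ?_
    have h1 : Tendsto Φ (𝓝[ball (0 : ℂ) 1] ζ) (𝓝 (Φ ζ)) :=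
      (hΦ ζ (by simp [hζ])).mono_left (nhdsWithin_mono _ ball_subset_closedBall)
    refine h1.congr' ?_
    filter_upwards [self_mem_nhdsWithin] with x hx
    exact hΦe hx
  have hsurj : ∀ a ∈ frontier G, ∃ t ∈ Icc (-Real.pi) Real.pi, γ t = a := by
    intro a ha
    have hc : IsClosed (Φ '' closedBall 0 1) :=
      ((isCompact_closedBall (0 : ℂ) 1).image_of_continuousOn hΦ).isClosed
    have hsub : G ⊆ Φ '' closedBall 0 1 := by
      intro y hy
      obtain ⟨x, hx, rfl⟩ := hφb.surjOn hy
      exact ⟨x, ball_subset_closedBall hx, hΦe hx⟩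
    rw [hGo.frontier_eq] at ha
    obtain ⟨z, hz, rfl⟩ := closure_minimal hsub hc ha.1
    have hz1 : ‖z‖ = 1 := by
      have h1 : ‖z‖ ≤ 1 := by simpa using hz
      rcases h1.lt_or_eq with h | h
      · exfalso
        have hzb : z ∈ ball (0 : ℂ) 1 := by simpa using h
        exact ha.2 (by rw [hΦe hzb]; exact hφb.mapsTo hzb)
      · exact h
    refine ⟨z.arg, ⟨(Complex.neg_pi_lt_arg z).le, Complex.arg_le_pi z⟩, ?_⟩
    have := Complex.norm_mul_exp_arg_mul_I z
    rw [hz1] at this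
    simp only [γ]
    congr 1
    simpa using this
  by_contra hcon
  push Not at hcon
  have hcon' : ∀ n : ℕ, ∃ s ∈ Icc (-Real.pi) Real.pi, ∃ t ∈ Icc (-Real.pi) Real.pi,
      dist (γ s) (γ t) < 1 / ((n : ℝ) + 1) ∧ ∀ B : Set ℂ, B ⊆ frontier G → γ s ∈ B → γ t ∈ B →
        IsCompact B → IsConnected B → ε ≤ diam B := by
    intro n
    obtain ⟨a, ha, b, hb, hab, h⟩ := hcon (1 / ((n : ℝ) + 1)) (by positivity)
    obtain ⟨s, hs, rfl⟩ := hsurj a ha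
    obtain ⟨t, ht, rfl⟩ := hsurj b hb
    exact ⟨s, hs, t, ht, hab, h⟩
  choose s hs t ht hst hB using hcon'
  obtain ⟨⟨x, y⟩, -, κ, hκ, hlim⟩ := (isCompact_Icc.prod isCompact_Icc).tendsto_subseq
    (x := fun n => (s n, t n)) (fun n => ⟨hs n, ht n⟩)
  have hx : Tendsto (fun n => s (κ n)) atTop (𝓝 x) := (continuous_fst.tendsto _).comp hlim
  have hy : Tendsto (fun n => t (κ n)) atTop (𝓝 y) := (continuous_snd.tendsto _).comp hlim
  have hxy : γ x = γ y := by
    have h1 : Tendsto (fun n => dist (γ (s (κ n))) (γ (t (κ n)))) atTop (𝓝 (dist (γ x) (γ y))) :=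
      (((hγ.tendsto x).comp hx).dist ((hγ.tendsto y).comp hy))
    have h2 : Tendsto (fun n => dist (γ (s (κ n))) (γ (t (κ n)))) atTop (𝓝 0) := by
      refine squeeze_zero (fun _ => dist_nonneg) (fun n => (hst (κ n)).le) ?_
      exact (tendsto_one_div_add_atTop_nhds_zero_nat (𝕜 := ℝ)).comp hκ.tendsto_atTop
    exact dist_eq_zero.1 (tendsto_nhds_unique h1 h2)
  have hnear : ∀ x : ℝ, ∃ r > 0, ∀ x', dist x' x < r → dist (γ x') (γ x) < ε / 4 := by
    intro x
    exact Metric.continuous_iff.1 hγ x (ε / 4) (by positivity)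
  obtain ⟨r1, hr1, h1⟩ := hnear x
  obtain ⟨r2, hr2, h2⟩ := hnear y
  obtain ⟨n, hn1, hn2⟩ := ((Metric.tendsto_nhds.1 hx r1 hr1).and
    (Metric.tendsto_nhds.1 hy r2 hr2)).exists
  have hseg : ∀ (x x' r : ℝ), dist x' x < r → ∀ u ∈ uIcc x' x, dist u x < r := by
    intro x x' r h u hu
    exact lt_of_le_of_lt (by
      have := Set.abs_sub_right_of_mem_uIcc hu
      rw [Real.dist_eq, Real.dist_eq, abs_sub_comm, abs_sub_comm x' x]; exact this) h
  let B := γ '' uIcc (s (κ n)) x ∪ γ '' uIcc (t (κ n)) y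
  have hBsub : B ⊆ closedBall (γ x) (ε / 4) := by
    rintro _ (⟨u, hu, rfl⟩ | ⟨u, hu, rfl⟩)
    · exact (h1 u (hseg _ _ _ hn1 u hu)).le
    · rw [hxy]
      exact (h2 u (hseg _ _ _ hn2 u hu)).le
  have hBd : diam B ≤ 2 * (ε / 4) :=
    (diam_mono hBsub isBounded_closedBall).trans (diam_closedBall (by positivity))
  have := hB (κ n) B ?_ ?_ ?_ ?_ ?_
  · linarith
  · rintro _ (⟨u, hu, rfl⟩ | ⟨u, hu, rfl⟩) <;> exact hγf u
  · exact Or.inl (mem_image_of_mem _ left_mem_uIcc)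
  · exact Or.inr (mem_image_of_mem _ left_mem_uIcc)
  · exact (isCompact_uIcc.image hγ).union (isCompact_uIcc.image hγ)
  · refine IsConnected.union ⟨γ x, mem_image_of_mem _ right_mem_uIcc, ?_⟩
      ⟨⟨_, mem_image_of_mem _ left_mem_uIcc⟩, isPreconnected_uIcc.image _ hγ.continuousOn⟩
      ⟨⟨_, mem_image_of_mem _ left_mem_uIcc⟩, isPreconnected_uIcc.image _ hγ.continuousOn⟩
    rw [hxy]
    exact mem_image_of_mem _ right_mem_uIcc


theorem cara_area {ψ : ℂ → ℂ} {Ω : Set ℂ} (hΩ : IsOpen Ω) (hd : DifferentiableOn ℂ ψ Ω)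
    (hi : InjOn ψ Ω) :
    ∫⁻ ζ in Ω, ‖deriv ψ ζ‖ₑ ^ 2 = volume (ψ '' Ω) := by
  have := lintegral_abs_det_fderiv_eq_addHaar_image (volume : Measure ℂ) (s := Ω) (f := ψ)
    (f' := fun ζ => (ContinuousLinearMap.toSpanSingleton ℂ (deriv ψ ζ)).restrictScalars ℝ)
    hΩ.measurableSet (fun x hx =>
      ((hd.differentiableAt (hΩ.mem_nhds hx)).hasDerivAt.hasFDerivAt.restrictScalars ℝ).hasFDerivWithinAt) hi
  rw [← this]
  refine lintegral_congr fun ζ => ?_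
  have h : ((ContinuousLinearMap.toSpanSingleton ℂ (deriv ψ ζ)).restrictScalars ℝ).det
      = ‖deriv ψ ζ‖ ^ 2 := by
    simp [ContinuousLinearMap.det, LinearMap.det_restrictScalars,
      Algebra.norm_complex_eq, Complex.normSq_eq_norm_sq]
  rw [h, abs_of_nonneg (by positivity), ENNReal.ofReal_pow (norm_nonneg _), ofReal_norm]

theorem cara_wolff {ψ : ℂ → ℂ} {Ω : Set ℂ} (hΩ : IsOpen Ω) (hd : DifferentiableOn ℂ ψ Ω)
    (hi : InjOn ψ Ω) (hfin : volume (ψ '' Ω) ≠ ⊤) {t : ℝ} (ht : 0 < t) :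
    ∃ s : ℝ, s < 0 ∧ ∀ α : ℝ, α ≤ Real.pi / 2 → (∀ θ ∈ Ioo (-α) α, (⟨s, θ⟩ : ℂ) ∈ Ω) →
      ∫⁻ θ in Ioo (-α) α, ‖deriv ψ ⟨s, θ⟩‖ₑ ≤ ENNReal.ofReal (5 * t) := by
  let F : ℂ → ENNReal := Ω.indicator fun ζ => ‖deriv ψ ζ‖ₑ ^ 2
  have hFm : Measurable F := by
    refine Measurable.indicator ?_ hΩ.measurableSet
    exact (measurable_deriv ψ).enorm.pow_const 2
  have hF : ∫⁻ x : ℝ, ∫⁻ y : ℝ, F ⟨x, y⟩ = volume (ψ '' Ω) := by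
    rw [← cara_area hΩ hd hi, ← lintegral_indicator hΩ.measurableSet,
      ← (Complex.volume_preserving_equiv_real_prod.symm).lintegral_comp hFm]
    rw [Measure.volume_eq_prod, lintegral_prod]
    · rfl
    · exact (hFm.comp Complex.measurableEquivRealProd.symm.measurable).aemeasurable
  obtain ⟨s, hs0, hs⟩ : ∃ s : ℝ, s < 0 ∧ ∫⁻ y : ℝ, F ⟨s, y⟩ < ENNReal.ofReal (t ^ 2) := by
    by_contra hcon
    push Not at hcon
    have h1 : ∫⁻ x in Iio (0 : ℝ), ENNReal.ofReal (t ^ 2) ≤ volume (ψ '' Ω) := by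
      rw [← hF]
      refine le_trans ?_ (setLIntegral_le_lintegral (Iio (0 : ℝ)) _)
      exact setLIntegral_mono' measurableSet_Iio fun x hx => hcon x hx
    rw [setLIntegral_const, Real.volume_Iio, ENNReal.mul_top] at h1
    · exact hfin (top_le_iff.1 h1)
    · simp; positivity
  refine ⟨s, hs0, fun α hα hαΩ => ?_⟩
  have htE : ENNReal.ofReal t ≠ 0 := by simpa using ht
  have htT : ENNReal.ofReal t ≠ ⊤ := ENNReal.ofReal_ne_top
  have hpt : ∀ x : ENNReal, x ≤ ENNReal.ofReal t + (ENNReal.ofReal t)⁻¹ * x ^ 2 := by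
    intro x
    rcases le_total x (ENNReal.ofReal t) with h | h
    · exact h.trans le_self_add
    · refine le_trans ?_ le_add_self
      calc x = (ENNReal.ofReal t)⁻¹ * ENNReal.ofReal t * x := by
            rw [ENNReal.inv_mul_cancel htE htT, one_mul]
        _ ≤ (ENNReal.ofReal t)⁻¹ * x * x := by gcongr
        _ = _ := by ring
  have hm : Measurable fun θ : ℝ => ‖deriv ψ ⟨s, θ⟩‖ₑ ^ 2 := by
    refine Measurable.pow_const ?_ 2
    refine ((measurable_deriv ψ).comp ?_).enorm
    have : Complex.mk s = fun θ : ℝ => (s : ℂ) + θ * Complex.I := by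
      ext θ; simp [Complex.ext_iff]
    rw [this]; fun_prop
  calc ∫⁻ θ in Ioo (-α) α, ‖deriv ψ ⟨s, θ⟩‖ₑ
      ≤ ∫⁻ θ in Ioo (-α) α, (ENNReal.ofReal t + (ENNReal.ofReal t)⁻¹ * ‖deriv ψ ⟨s, θ⟩‖ₑ ^ 2) :=
        lintegral_mono fun θ => hpt _
    _ = ENNReal.ofReal t * volume (Ioo (-α) α) +
        (ENNReal.ofReal t)⁻¹ * ∫⁻ θ in Ioo (-α) α, ‖deriv ψ ⟨s, θ⟩‖ₑ ^ 2 := by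
        rw [lintegral_add_left measurable_const, setLIntegral_const, lintegral_const_mul _ hm]
    _ ≤ ENNReal.ofReal t * ENNReal.ofReal 4 + (ENNReal.ofReal t)⁻¹ * ENNReal.ofReal (t ^ 2) := by
        gcongr
        · rw [Real.volume_Ioo]
          apply ENNReal.ofReal_le_ofReal
          linarith [Real.pi_lt_four]
        · refine le_trans ?_ hs.le
          refine le_trans ?_ (setLIntegral_le_lintegral (Ioo (-α) α) _)
          refine setLIntegral_mono' measurableSet_Ioo fun θ hθ => ?_
          simp only [F]
          rw [indicator_of_mem (hαΩ θ hθ)]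
    _ = ENNReal.ofReal (5 * t) := by
        rw [← ENNReal.ofReal_inv_of_pos ht, ← ENNReal.ofReal_mul ht.le,
          ← ENNReal.ofReal_mul (by positivity), ← ENNReal.ofReal_add (by positivity) (by positivity)]
        congr 1
        field_simp
        ring

theorem cara_curve {γ γ' : ℝ → ℂ} {α L : ℝ} (hα : 0 < α) (hL : 0 ≤ L)
    (hd : ∀ x ∈ Ioo (-α) α, HasDerivAt γ (γ' x) x) (hm : AEStronglyMeasurable γ' volume)
    (hl : ∫⁻ x in Ioo (-α) α, ‖γ' x‖ₑ ≤ ENNReal.ofReal L) :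
    ∃ Γ : ℝ → ℂ, ContinuousOn Γ (Icc (-α) α) ∧ EqOn Γ γ (Ioo (-α) α) ∧
      ∀ x ∈ Icc (-α) α, ∀ y ∈ Icc (-α) α, dist (Γ x) (Γ y) ≤ L := by
  have hIoo : IntegrableOn γ' (Ioo (-α) α) :=
    ⟨hm.restrict, lt_of_le_of_lt hl ENNReal.ofReal_lt_top⟩
  have hle : -α ≤ α := by linarith
  have hii : IntervalIntegrable γ' volume (-α) α := by
    rw [intervalIntegrable_iff_integrableOn_Ioo_of_le hle]; exact hIoo
  have h0 : (0 : ℝ) ∈ Icc (-α) α := ⟨by linarith, hα.le⟩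
  have hsub : ∀ x ∈ Icc (-α) α, ∀ y ∈ Icc (-α) α, IntervalIntegrable γ' volume x y := by
    intro x hx y hy
    refine hii.mono_set ?_
    rw [uIcc_of_le hle]
    exact uIcc_subset_Icc hx hy
  refine ⟨fun x => γ 0 + ∫ u in (0 : ℝ)..x, γ' u, ?_, ?_, ?_⟩
  · refine continuousOn_const.add ?_
    have := intervalIntegral.continuousOn_primitive_interval' hii (a := 0)
      (by rw [uIcc_of_le hle]; exact h0)
    rwa [uIcc_of_le hle] at this
  · intro x hx
    have h0' : (0 : ℝ) ∈ Ioo (-α) α := ⟨by linarith, hα⟩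
    have := intervalIntegral.integral_eq_sub_of_hasDerivAt (a := 0) (b := x) (f := γ) (f' := γ')
      (fun u hu => hd u ((ordConnected_Ioo.uIcc_subset h0' hx) hu))
      (hsub 0 h0 x (Ioo_subset_Icc_self hx))
    simp only [this]; ring
  · intro x hx y hy
    wlog hxy : y ≤ x generalizing x y
    · rw [dist_comm]; exact this y hy x hx (le_of_not_ge hxy)
    have e : (γ 0 + ∫ u in (0 : ℝ)..x, γ' u) - (γ 0 + ∫ u in (0 : ℝ)..y, γ' u) =
        ∫ u in y..x, γ' u := by
      rw [add_sub_add_left_eq_sub, intervalIntegral.integral_interval_sub_left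
        (hsub 0 h0 x hx) (hsub 0 h0 y hy)]
    rw [dist_eq_norm, e, intervalIntegral.integral_of_le hxy]
    have h2 : ‖∫ u in Ioc y x, γ' u‖ₑ ≤ ENNReal.ofReal L := by
      refine (enorm_integral_le_lintegral_enorm _).trans (le_trans ?_ hl)
      rw [← restrict_Ioo_eq_restrict_Ioc]
      exact lintegral_mono_set (Ioo_subset_Ioo hy.1 hx.2)
    rw [← ofReal_norm] at h2
    exact (ENNReal.ofReal_le_ofReal_iff hL).1 h2


theorem cara_normSq_one_sub_exp (s θ : ℝ) :
    ‖1 - Complex.exp ⟨s, θ⟩‖ ^ 2 = 1 + Real.exp s * (Real.exp s - 2 * Real.cos θ) := by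
  rw [← Complex.normSq_eq_norm_sq, Complex.normSq_apply]
  simp only [Complex.sub_re, Complex.sub_im, Complex.one_re, Complex.one_im, Complex.exp_re,
    Complex.exp_im]
  linear_combination (Real.exp s) ^ 2 * Real.sin_sq_add_cos_sq θ

theorem cara_crosscut {G : Set ℂ} (hGo : IsOpen G) (hGb : Bornology.IsBounded G)
    {φ : ℂ → ℂ} (hφd : DifferentiableOn ℂ φ (ball 0 1))
    (hφb : BijOn φ (ball 0 1) G) {z₀ : ℂ} (hz₀ : ‖z₀‖ = 1) {t : ℝ} (ht : 0 < t) :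
    ∃ (ρ α : ℝ) (Γ : ℝ → ℂ), 0 < ρ ∧ ρ < 1 ∧ 0 < α ∧ ContinuousOn Γ (Icc (-α) α) ∧
      Γ '' (Ioo (-α) α) ⊆ G ∧ φ '' (ball 0 1 ∩ sphere z₀ ρ) ⊆ Γ '' (Icc (-α) α) ∧
      Γ (-α) ∈ frontier G ∧ Γ α ∈ frontier G ∧
      ∀ x ∈ Icc (-α) α, ∀ y ∈ Icc (-α) α, dist (Γ x) (Γ y) ≤ 5 * t := by
  have hz0 : z₀ ≠ 0 := by intro h; simp [h] at hz₀
  let χ : ℂ → ℂ := fun ζ => z₀ * (1 - Complex.exp ζ)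
  let ψ : ℂ → ℂ := fun ζ => φ (χ ζ)
  let Ω : Set ℂ := {ζ | ζ.im ∈ Ioo (-Real.pi) Real.pi ∧ ‖1 - Complex.exp ζ‖ < 1}
  have hχn : ∀ ζ, ‖χ ζ‖ = ‖1 - Complex.exp ζ‖ := fun ζ => by simp [χ, hz₀]
  have hΩo : IsOpen Ω :=
    (isOpen_Ioo.preimage Complex.continuous_im).inter (isOpen_lt
      (f := fun ζ : ℂ => ‖1 - Complex.exp ζ‖) (by fun_prop) continuous_const)
  have hχΩ : MapsTo χ Ω (ball 0 1) := fun ζ hζ => by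
    simpa [hχn] using hζ.2
  have hψd : DifferentiableOn ℂ ψ Ω := by
    refine hφd.comp ?_ hχΩ
    dsimp only [χ]; fun_prop
  have hψi : InjOn ψ Ω := by
    intro x hx y hy hxy
    have h1 := hφb.injOn (hχΩ hx) (hχΩ hy) hxy
    have h2 : Complex.exp x = Complex.exp y := by
      have := mul_left_cancel₀ hz0 h1
      linear_combination -this
    exact Complex.exp_inj_of_neg_pi_lt_of_le_pi hx.1.1 hx.1.2.le hy.1.1 hy.1.2.le h2
  have hfin : volume (ψ '' Ω) ≠ ⊤ := by
    have : ψ '' Ω ⊆ G := by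
      rintro _ ⟨x, hx, rfl⟩
      exact hφb.mapsTo (hχΩ hx)
    exact ((measure_mono this).trans_lt hGb.measure_lt_top).ne
  obtain ⟨s, hs0, hs⟩ := cara_wolff hΩo hψd hψi hfin ht
  have hes : 0 < Real.exp s := Real.exp_pos s
  have hes1 : Real.exp s < 1 := by simpa using hs0
  let α := Real.arccos (Real.exp s / 2)
  have hα0 : 0 < α := Real.arccos_pos.2 (by linarith)
  have hα2 : α ≤ Real.pi / 2 := Real.arccos_le_pi_div_two.2 (by linarith)
  have hcosα : Real.cos α = Real.exp s / 2 := Real.cos_arccos (by linarith) (by linarith)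
  have hlt : ∀ θ ∈ Ioo (-α) α, ‖1 - Complex.exp ⟨s, θ⟩‖ < 1 := by
    intro θ hθ
    have h1 : Real.cos α < Real.cos θ := by
      rw [← Real.cos_abs θ]
      exact Real.cos_lt_cos_of_nonneg_of_le_pi (abs_nonneg _) (by linarith [Real.pi_pos])
        (abs_lt.2 hθ)
    have h2 := cara_normSq_one_sub_exp s θ
    rw [hcosα] at h1
    have : ‖1 - Complex.exp ⟨s, θ⟩‖ ^ 2 < 1 := by rw [h2]; nlinarith
    nlinarith [norm_nonneg (1 - Complex.exp ⟨s, θ⟩)]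
  have heq : ∀ θ : ℝ, Real.cos θ = Real.exp s / 2 → ‖1 - Complex.exp ⟨s, θ⟩‖ = 1 := by
    intro θ hθ
    have h2 := cara_normSq_one_sub_exp s θ
    rw [hθ] at h2
    have : ‖1 - Complex.exp ⟨s, θ⟩‖ ^ 2 = 1 := by rw [h2]; ring
    nlinarith [norm_nonneg (1 - Complex.exp ⟨s, θ⟩)]
  have hαΩ : ∀ θ ∈ Ioo (-α) α, (⟨s, θ⟩ : ℂ) ∈ Ω := fun θ hθ =>
    ⟨⟨by simp only; linarith [hθ.1, Real.pi_pos], by simp only; linarith [hθ.2, Real.pi_pos]⟩, hlt θ hθ⟩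
  have hmk : Complex.mk s = fun θ : ℝ => (s : ℂ) + θ * Complex.I := by
    ext θ; simp [Complex.ext_iff]
  have hmkc : Continuous (Complex.mk s) := by rw [hmk]; fun_prop
  have hmkd : ∀ θ : ℝ, HasDerivAt (Complex.mk s) Complex.I θ := by
    intro θ
    rw [hmk]
    simpa using ((Complex.ofRealCLM.hasDerivAt (x := θ)).mul_const Complex.I).const_add (s : ℂ)
  have hL := hs α hα2 hαΩ
  obtain ⟨Γ, hΓc, hΓe, hΓd⟩ := cara_curve (γ := fun θ => ψ ⟨s, θ⟩)
    (γ' := fun θ => deriv ψ ⟨s, θ⟩ * Complex.I) (L := 5 * t) hα0 (by positivity)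
    (by
      intro θ hθ
      have h1 := (hψd.differentiableAt (hΩo.mem_nhds (hαΩ θ hθ))).hasDerivAt
      exact h1.comp_of_eq θ (hmkd θ) rfl)
    (by
      refine Measurable.aestronglyMeasurable ?_
      exact ((measurable_deriv ψ).comp hmkc.measurable).mul_const _)
    (by
      have hI : ‖Complex.I‖ₑ = 1 := by rw [← ofReal_norm, Complex.norm_I, ENNReal.ofReal_one]
      simpa only [enorm_mul, hI, mul_one] using hL)
  have hχc : Continuous fun θ : ℝ => χ ⟨s, θ⟩ := by
    have : Continuous χ := by dsimp only [χ]; fun_prop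
    exact this.comp hmkc
  have hend : ∀ e ∈ Icc (-α) α, Real.cos e = Real.exp s / 2 → Γ e ∈ frontier G := by
    intro e he hce
    have hcl : e ∈ closure (Ioo (-α) α) := by
      rw [closure_Ioo (by linarith)]; exact he
    have : (𝓝[Ioo (-α) α] e).NeBot := mem_closure_iff_nhdsWithin_neBot.1 hcl
    refine cara_limit_frontier hGo hφd hφb (l := 𝓝[Ioo (-α) α] e) (u := fun θ => χ ⟨s, θ⟩)
      (ζ := χ ⟨s, e⟩) ?_ ?_ ?_ ?_
    · filter_upwards [self_mem_nhdsWithin] with θ hθ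
      exact hχΩ (hαΩ θ hθ)
    · exact (hχc.tendsto e).mono_left nhdsWithin_le_nhds
    · rw [hχn, heq e hce]
    · refine Tendsto.congr' ?_ ((hΓc e he).mono_left (nhdsWithin_mono _ Ioo_subset_Icc_self))
      filter_upwards [self_mem_nhdsWithin] with θ hθ
      exact hΓe hθ
  refine ⟨Real.exp s, α, Γ, hes, hes1, hα0, hΓc, ?_, ?_, ?_, ?_, hΓd⟩
  · rintro _ ⟨θ, hθ, rfl⟩
    rw [hΓe hθ]
    exact hφb.mapsTo (hχΩ (hαΩ θ hθ))
  · rintro _ ⟨z, ⟨hz1, hz2⟩, rfl⟩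
    let w := 1 - z / z₀
    have hzw : z₀ * (1 - w) = z := by simp only [w]; field_simp; ring
    have hwn : ‖w‖ = Real.exp s := by
      have h1 : z₀ * w = - (z - z₀) := by simp only [w]; field_simp; ring
      have h2 : ‖z₀ * w‖ = ‖z - z₀‖ := by rw [h1, norm_neg]
      rw [norm_mul, hz₀, one_mul] at h2
      rw [h2]; simpa [dist_eq_norm] using hz2
    have hw0 : w ≠ 0 := by
      intro h; rw [h, norm_zero] at hwn; linarith
    have hwe : Complex.exp ⟨s, w.arg⟩ = w := by
      have : (⟨s, w.arg⟩ : ℂ) = Complex.log w := by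
        apply Complex.ext
        · simp [Complex.log_re, hwn]
        · simp [Complex.log_im]
      rw [this, Complex.exp_log hw0]
    have hχz : χ ⟨s, w.arg⟩ = z := by simp only [χ, hwe, hzw]
    have hlt1 : ‖1 - Complex.exp ⟨s, w.arg⟩‖ < 1 := by
      rw [← hχn, hχz]; simpa using hz1
    have hcos : Real.exp s / 2 < Real.cos w.arg := by
      have h2 := cara_normSq_one_sub_exp s w.arg
      have h3 : ‖1 - Complex.exp ⟨s, w.arg⟩‖ ^ 2 < 1 := by
        nlinarith [norm_nonneg (1 - Complex.exp ⟨s, w.arg⟩)]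
      rw [h2] at h3
      by_contra hcon
      push Not at hcon
      nlinarith
    have harg : w.arg ∈ Ioo (-α) α := by
      rw [mem_Ioo, ← abs_lt]
      by_contra hcon
      push Not at hcon
      have := Real.cos_le_cos_of_nonneg_of_le_pi hα0.le (Complex.abs_arg_le_pi w) hcon
      rw [Real.cos_abs, hcosα] at this
      linarith
    refine ⟨w.arg, Ioo_subset_Icc_self harg, ?_⟩
    rw [hΓe harg]
    simp only [ψ, hχz]
  · exact hend _ ⟨le_rfl, by linarith⟩ (by rw [Real.cos_neg, hcosα])
  · exact hend _ ⟨by linarith, le_rfl⟩ hcosα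

theorem cara_small {G : Set ℂ} (hGo : IsOpen G) (hGb : Bornology.IsBounded G)
    (hGc : IsConnected G)
    {φ : ℂ → ℂ} (hφd : DifferentiableOn ℂ φ (ball 0 1))
    (hφb : BijOn φ (ball 0 1) G)
    (hlc : ∀ ε : ℝ, 0 < ε → ∃ δ : ℝ, 0 < δ ∧ ∀ a ∈ frontier G, ∀ b ∈ frontier G,
      dist a b < δ → ∃ B : Set ℂ, B ⊆ frontier G ∧ a ∈ B ∧ b ∈ B ∧
        IsCompact B ∧ IsConnected B ∧ diam B < ε)
    {z₀ : ℂ} (hz₀ : ‖z₀‖ = 1) {ε : ℝ} (hε : 0 < ε)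
    (hε0 : ball (φ 0) ε ⊆ G) :
    ∃ ρ > 0, ∃ a : ℂ, ∀ z ∈ ball (0 : ℂ) 1 ∩ ball z₀ ρ, φ z ∈ ball a ε := by
  obtain ⟨δ, hδ, hloc⟩ := hlc ε hε
  have hmin : 0 < min δ ε := lt_min hδ hε
  obtain ⟨ρ, α, Γ, hρ, hρ1, hα, hΓc, hΓG, hΓC, hfa, hfb, hΓd⟩ :=
    cara_crosscut hGo hGb hφd hφb hz₀ (t := min δ ε / 10) (by positivity)
  have hl : -α ∈ Icc (-α) α := ⟨le_rfl, by linarith⟩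
  have hr : α ∈ Icc (-α) α := ⟨by linarith, le_rfl⟩
  have hd1 : 5 * (min δ ε / 10) < δ := by linarith [min_le_left δ ε]
  have hd2 : 5 * (min δ ε / 10) < ε := by linarith [min_le_right δ ε]
  obtain ⟨B, hBf, haB, hbB, hBc, hBconn, hBd⟩ :=
    hloc _ hfa _ hfb ((hΓd _ hl _ hr).trans_lt hd1)
  refine ⟨ρ, hρ, Γ (-α), fun z hz => ?_⟩
  by_contra hpz
  have hBG : B ⊆ Gᶜ := fun x hx => by
    have := hBf hx
    rw [hGo.frontier_eq] at this
    exact this.2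
  have h0 : (0 : ℂ) ∈ ball (0 : ℂ) 1 := by simp
  have hVo : IsOpen (φ '' (ball 0 1 ∩ (closedBall z₀ ρ)ᶜ)) :=
    cara_open_image hφd hφb inter_subset_left (isOpen_ball.inter isClosed_closedBall.isOpen_compl)
  have hUo : IsOpen (φ '' (ball 0 1 ∩ ball z₀ ρ)) :=
    cara_open_image hφd hφb inter_subset_left (isOpen_ball.inter isOpen_ball)
  have hUG : φ '' (ball 0 1 ∩ ball z₀ ρ) ⊆ G :=
    (image_mono inter_subset_left).trans hφb.mapsTo.image_subset
  have hUV : Disjoint (φ '' (ball 0 1 ∩ (closedBall z₀ ρ)ᶜ))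
      (closure (φ '' (ball 0 1 ∩ ball z₀ ρ))) := by
    refine Disjoint.closure_right ?_ hVo
    rw [Set.disjoint_left]
    rintro _ ⟨x, hx, rfl⟩ ⟨y, hy, hxy⟩
    have := hφb.injOn hy.1 hx.1 hxy
    rw [this] at hy
    exact hx.2 (ball_subset_closedBall hy.2)
  have hKi : Gᶜ ∩ (Γ '' Icc (-α) α ∪ B) = B := by
    apply Subset.antisymm
    · rintro x ⟨hxG, ⟨θ, hθ, rfl⟩ | hx⟩
      · rcases eq_endpoints_or_mem_Ioo_of_mem_Icc hθ with h | h | h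
        · rw [h]; exact haB
        · rw [h]; exact hbB
        · exact absurd (hΓG (mem_image_of_mem _ h)) hxG
      · exact hx
    · exact fun x hx => ⟨hBG hx, Or.inr hx⟩
  refine cara_separation (G := G) (U := φ '' (ball 0 1 ∩ ball z₀ ρ)) (K := Γ '' Icc (-α) α ∪ B)
    (p := φ z) (q := φ 0) (a := Γ (-α)) hε hGo hGc.isPreconnected (hGb.subset hUG) hUG
    (mem_image_of_mem _ hz) (hφb.mapsTo h0) ?_ ?_ ?_ ?_ ?_ hpz ?_
  · refine Set.disjoint_left.1 hUV (mem_image_of_mem _ ⟨h0, ?_⟩)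
    simp [dist_eq_norm, hz₀, hρ1]
  · exact (isCompact_Icc.image_of_continuousOn hΓc).isClosed.union hBc.isClosed
  · rintro x (⟨θ, hθ, rfl⟩ | hx)
    · exact (hΓd _ hθ _ hl).trans_lt hd2
    · exact (dist_le_diam_of_mem hBc.isBounded hx haB).trans_lt hBd
  · intro x hx
    rw [hUo.frontier_eq] at hx
    by_cases hxG : x ∈ G
    · right; left
      obtain ⟨w, hw, rfl⟩ := hφb.surjOn hxG
      apply hΓC
      refine mem_image_of_mem _ ⟨hw, ?_⟩
      rw [mem_sphere]
      apply le_antisymm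
      · by_contra hcon
        exact Set.disjoint_left.1 hUV (mem_image_of_mem _ ⟨hw, by simpa using hcon⟩) hx.1
      · by_contra hcon
        exact hx.2 (mem_image_of_mem _ ⟨hw, by simpa using hcon⟩)
    · exact Or.inl hxG
  · rw [hKi]; exact hBconn
  · intro h
    have : Γ (-α) ∈ ball (φ 0) ε := by rw [mem_ball'] at h; exact h
    exact hBG haB (hε0 this)

theorem cara_backward {G : Set ℂ} (hGo : IsOpen G) (hGb : Bornology.IsBounded G)
    (hGc : IsConnected G)
    {φ : ℂ → ℂ} (hφd : DifferentiableOn ℂ φ (ball 0 1))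
    (hφb : BijOn φ (ball 0 1) G)
    (hlc : ∀ ε : ℝ, 0 < ε → ∃ δ : ℝ, 0 < δ ∧ ∀ a ∈ frontier G, ∀ b ∈ frontier G,
      dist a b < δ → ∃ B : Set ℂ, B ⊆ frontier G ∧ a ∈ B ∧ b ∈ B ∧
        IsCompact B ∧ IsConnected B ∧ diam B < ε) :
    ∃ Φ : ℂ → ℂ, ContinuousOn Φ (closedBall 0 1) ∧ EqOn Φ φ (ball 0 1) := by
  refine ⟨extendFrom (ball 0 1) φ, continuousOn_extendFrom ?_ ?_,
    extendFrom_extends hφd.continuousOn⟩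
  · rw [closure_ball _ one_ne_zero]
  intro z₀ hz
  have h1 : ‖z₀‖ ≤ 1 := by simpa using hz
  rcases h1.lt_or_eq with h | h
  · exact ⟨φ z₀, hφd.continuousOn z₀ (by simpa using h)⟩
  have hcl : z₀ ∈ closure (ball (0 : ℂ) 1) := by
    rw [closure_ball _ one_ne_zero]; exact hz
  have : (𝓝[ball (0 : ℂ) 1] z₀).NeBot := mem_closure_iff_nhdsWithin_neBot.1 hcl
  refine cauchy_map_iff_exists_tendsto.1 ?_
  rw [Metric.cauchy_iff]
  refine ⟨inferInstance, fun ε hε => ?_⟩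
  obtain ⟨r, hr, hrG⟩ := Metric.isOpen_iff.1 hGo (φ 0) (hφb.mapsTo (by simp))
  obtain ⟨ρ, hρ, a, ha⟩ := cara_small hGo hGb hGc hφd hφb hlc h (ε := min r (ε / 2))
    (by positivity) ((ball_subset_ball (min_le_left _ _)).trans hrG)
  refine ⟨φ '' (ball 0 1 ∩ ball z₀ ρ), image_mem_map
    (inter_mem self_mem_nhdsWithin (mem_nhdsWithin_of_mem_nhds (ball_mem_nhds _ hρ))), ?_⟩
  rintro _ ⟨x, hx, rfl⟩ _ ⟨y, hy, rfl⟩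
  have h1 := mem_ball.1 (ha x hx)
  have h2 := mem_ball'.1 (ha y hy)
  have h3 := min_le_right r (ε / 2)
  calc dist (φ x) (φ y) ≤ dist (φ x) a + dist a (φ y) := dist_triangle _ _ _
    _ < ε := by linarith

end caraHelpers


/-- Carathéodory extension theorem: a conformal map `φ` from the open unit disc
onto a bounded simply connected domain `G` extends continuously to the closed
disc if and only if `∂G` is locally connected. -/
theorem caratheodory_continuous_extension_iff_locally_connected
    (G : Set ℂ) (hGo : IsOpen G) (hGb : Bornology.IsBounded G)
    (hGc : IsConnected G) (hGs : SimplyConnectedSpace G)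
    (φ : ℂ → ℂ) (hφd : DifferentiableOn ℂ φ (Metric.ball 0 1))
    (hφb : Set.BijOn φ (Metric.ball 0 1) G) :
    (∃ Φ : ℂ → ℂ, ContinuousOn Φ (Metric.closedBall 0 1) ∧
      Set.EqOn Φ φ (Metric.ball 0 1)) ↔
    (∀ ε : ℝ, 0 < ε → ∃ δ : ℝ, 0 < δ ∧ ∀ a ∈ frontier G, ∀ b ∈ frontier G,
      dist a b < δ → ∃ B : Set ℂ, B ⊆ frontier G ∧ a ∈ B ∧ b ∈ B ∧
        IsCompact B ∧ IsConnected B ∧ Metric.diam B < ε) := by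
  constructor
  · rintro ⟨Φ, hΦ, hΦe⟩ ε hε
    exact cara_forward G hGo φ hφd hφb Φ hΦ hΦe ε hε
  · intro h
    exact cara_backward hGo hGb hGc hφd hφb h
end

section
/- A conformal map φ from the open unit disc 𝔻 onto a bounded simply connected domain G has a continuous and injective extension to the closed disc 𝔻̄ if and only if ∂G is a Jordan curve. -/
namespace CaraProof

open Set Filter Topology

/-- exterior of a closed disc is connected -/
lemma ext_preconnected (c : ℂ) (R : ℝ) (_hR : 0 ≤ R) :
    IsPreconnected (Metric.closedBall c R)ᶜ := by
  have h : (Metric.closedBall c R)ᶜ =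
      (fun x : ℝ × ℝ => c + x.1 * Complex.exp (x.2 * Complex.I)) '' (Ioi R ×ˢ univ) := by
    ext z
    simp only [mem_compl_iff, Metric.mem_closedBall, not_le, mem_image, mem_prod, mem_Ioi,
      mem_univ, and_true, Prod.exists]
    constructor
    · intro hz
      refine ⟨‖z - c‖, (z - c).arg, by rwa [← dist_eq_norm], ?_⟩
      rw [Complex.norm_mul_exp_arg_mul_I]; ring
    · rintro ⟨a, b, hab, rfl⟩
      rw [dist_eq_norm]
      simp only [add_sub_cancel_left, norm_mul, Complex.norm_real, Complex.norm_exp_ofReal_mul_I,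
        mul_one, Real.norm_eq_abs]
      exact lt_of_lt_of_le hab (le_abs_self a)
  rw [h]
  apply (isPreconnected_Ioi.prod isPreconnected_univ).image
  fun_prop

/-- a continuous function on a preconnected set with exp = 1 is constant -/
lemma const_of_exp_eq {X : Type*} [TopologicalSpace X] {S : Set X} (hS : IsPreconnected S)
    (f : X → ℂ) (hf : ContinuousOn f S) (a : ℂ) (h : ∀ x ∈ S, Complex.exp (f x) = a)
    {x y : X} (hx : x ∈ S) (hy : y ∈ S) : f x = f y := by
  set g : X → ℝ := fun x => (f x - f y).im / (2 * Real.pi) with hg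
  have hgc : ContinuousOn g S := by
    apply ContinuousOn.div_const
    exact Complex.continuous_im.comp_continuousOn (hf.sub continuousOn_const)
  have key : ∀ z ∈ S, ∃ n : ℤ, f z = f y + n * (2 * Real.pi * Complex.I) := by
    intro z hz
    exact Complex.exp_eq_exp_iff_exists_int.mp ((h z hz).trans (h y hy).symm)
  have hgn : ∀ z ∈ S, ∃ n : ℤ, g z = n := by
    intro z hz
    obtain ⟨n, hn⟩ := key z hz
    refine ⟨n, ?_⟩
    simp only [hg, hn]
    have : Real.pi ≠ 0 := Real.pi_ne_zero
    simp
  obtain ⟨n, hn⟩ := key x hx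
  have hgx : g x = n := by
    simp only [hg, hn]
    have : Real.pi ≠ 0 := Real.pi_ne_zero
    simp
  have hgy : g y = 0 := by simp [hg]
  have hord := (hS.image g hgc).ordConnected
  have hn0 : n = 0 := by
    by_contra hne
    have h0 : (0 : ℝ) ∈ g '' S := ⟨y, hy, hgy⟩
    have h1 : (n : ℝ) ∈ g '' S := ⟨x, hx, hgx⟩
    rcases lt_or_gt_of_ne hne with hlt | hlt
    · have hle : (n : ℝ) ≤ -1 := by exact_mod_cast (by omega : n ≤ -1)
      obtain ⟨z, hz, hz2⟩ := hord.out h1 h0 (show (-(1 / 2) : ℝ) ∈ Icc (n : ℝ) 0 from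
        ⟨by linarith, by norm_num⟩)
      obtain ⟨m, hm⟩ := hgn z hz
      rw [hm] at hz2
      have : (2 * m : ℝ) = -1 := by linarith
      have : 2 * m = -1 := by exact_mod_cast this
      omega
    · have hle : (1 : ℝ) ≤ n := by exact_mod_cast (by omega : 1 ≤ n)
      obtain ⟨z, hz, hz2⟩ := hord.out h0 h1 (show ((1 / 2) : ℝ) ∈ Icc 0 (n : ℝ) from
        ⟨by norm_num, by linarith⟩)
      obtain ⟨m, hm⟩ := hgn z hz
      rw [hm] at hz2
      have : (2 * m : ℝ) = 1 := by linarith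
      have : 2 * m = 1 := by exact_mod_cast this
      omega
  rw [hn, hn0]; simp

/-- points in a common connected subset of the complement give a continuous logarithm -/
lemma exists_log_of_connected {K S : Set ℂ} (hK : IsCompact K) (hS : IsPreconnected S)
    (hSK : Disjoint S K) {p q : ℂ} (hp : p ∈ S) (hq : q ∈ S) :
    ∃ g : ℂ → ℂ, ContinuousOn g K ∧ ∀ z ∈ K, Complex.exp (g z) = (z - p) / (z - q) := by
  have hne : ∀ x ∈ S, ∀ z ∈ K, z - x ≠ 0 := by
    intro x hx z hz h
    exact Set.disjoint_left.mp hSK hx (by rwa [← sub_eq_zero.mp h])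
  refine hS.induction₂' (fun p q => ∃ g : ℂ → ℂ, ContinuousOn g K ∧
    ∀ z ∈ K, Complex.exp (g z) = (z - p) / (z - q)) ?_ ?_ hp hq
  · intro x hx
    have hxK : x ∈ Kᶜ := fun h => Set.disjoint_left.mp hSK hx h
    obtain ⟨ε, hε, hball⟩ := Metric.isOpen_iff.mp hK.isClosed.isOpen_compl x hxK
    have hnear : ∀ z ∈ K, ε ≤ ‖z - x‖ := by
      intro z hz
      by_contra hlt
      push Not at hlt
      exact hball (by rwa [Metric.mem_ball, dist_eq_norm]) hz
    have hev : ∀ᶠ y in 𝓝[S] x, y ∈ Metric.ball x ε ∩ S :=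
      inter_mem (mem_nhdsWithin_of_mem_nhds (Metric.ball_mem_nhds x hε)) self_mem_nhdsWithin
    filter_upwards [hev] with y hy
    have hyx : ‖y - x‖ < ε := by simpa [dist_eq_norm] using hy.1
    have hslit : ∀ z ∈ K, (z - y) / (z - x) ∈ Complex.slitPlane := by
      intro z hz
      have h0 := hne x hx z hz
      have hb : ‖(x - y) / (z - x)‖ < 1 := by
        rw [norm_div, div_lt_one (norm_pos_iff.mpr h0), norm_sub_rev]
        exact lt_of_lt_of_le hyx (hnear z hz)
      have : (z - y) / (z - x) = 1 + (x - y) / (z - x) := by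
        field_simp; ring
      rw [this]
      exact Complex.mem_slitPlane_of_norm_lt_one hb
    have hcl : ContinuousOn (fun z => Complex.log ((z - y) / (z - x))) K := by
      apply ContinuousOn.clog _ hslit
      exact ContinuousOn.div (by fun_prop) (by fun_prop) (fun z hz => hne x hx z hz)
    constructor
    · refine ⟨fun z => - Complex.log ((z - y) / (z - x)), hcl.neg, ?_⟩
      intro z hz
      rw [Complex.exp_neg, Complex.exp_log, inv_div]
      exact div_ne_zero (hne y hy.2 z hz) (hne x hx z hz)
    · refine ⟨fun z => Complex.log ((z - y) / (z - x)), hcl, ?_⟩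
      intro z hz
      rw [Complex.exp_log]
      exact div_ne_zero (hne y hy.2 z hz) (hne x hx z hz)
  · rintro x y w hx hy hw ⟨g, hg, hg2⟩ ⟨h, hh, hh2⟩
    refine ⟨fun z => g z + h z, hg.add hh, ?_⟩
    intro z hz
    rw [Complex.exp_add, hg2 z hz, hh2 z hz]
    have := hne y hy z hz
    have := hne w hw z hz
    field_simp

/-- no nonvanishing continuous function on the plane agrees with `z - p` near infinity -/
lemma no_extension (p : ℂ) (R : ℝ) (hR : 0 < R) (r : ℂ → ℂ) (hr : Continuous r)
    (h0 : ∀ z, r z ≠ 0) (hfar : ∀ z, ‖z - p‖ = R → r z = z - p) : False := by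
  have hsc : IsSimplyConnected (univ : Set ℂ) := by
    have : ContractibleSpace (univ : Set ℂ) :=
      convex_univ.contractibleSpace ⟨0, mem_univ _⟩
    exact (inferInstance : SimplyConnectedSpace (univ : Set ℂ))
  obtain ⟨f, hf, hf2⟩ := Complex.exists_continuousOn_eqOn_exp_comp hsc isOpen_univ
    hr.continuousOn (by rintro ⟨z, -, hz⟩; exact h0 z hz)
  rw [continuousOn_univ] at hf
  let k : ℝ → ℂ := fun t => f (p + R * Complex.exp (t * Complex.I)) - t * Complex.I
  have hk : ContinuousOn k univ := by
    apply Continuous.continuousOn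
    exact (hf.comp (by fun_prop)).sub (by fun_prop)
  have hkR : ∀ t ∈ (univ : Set ℝ), Complex.exp (k t) = R := by
    intro t _
    have h1 := hf2 (mem_univ (p + R * Complex.exp (t * Complex.I)))
    simp only [Function.comp] at h1
    simp only [k]
    rw [Complex.exp_sub, h1, hfar]
    · rw [add_sub_cancel_left]
      field_simp
    · simp [abs_of_pos hR]
  have := const_of_exp_eq isPreconnected_univ k hk R hkR (mem_univ 0) (mem_univ (2 * Real.pi))
  simp [k, Complex.exp_two_pi_mul_I] at this
  have h3 : (2 * (Real.pi : ℂ) * Complex.I) = 0 := by linear_combination this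
  simp [Real.pi_ne_zero] at h3

/-- Borsuk-type lemma, bounded component case -/
lemma borsuk_bounded {K : Set ℂ} (hK : IsCompact K) {p q : ℂ} (hp : p ∉ K) (hq : q ∉ K)
    (g : ℂ → ℂ) (hg : ContinuousOn g K) (hg2 : ∀ z ∈ K, Complex.exp (g z) = (z - p) / (z - q))
    (hb : Bornology.IsBounded (connectedComponentIn Kᶜ p))
    (hqU : q ∉ connectedComponentIn Kᶜ p) : False := by
  classical
  set U := connectedComponentIn Kᶜ p with hU
  have hUo : IsOpen U := hK.isClosed.isOpen_compl.connectedComponentIn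
  have hpU : p ∈ U := mem_connectedComponentIn hp
  have hfr : frontier U ⊆ K := by
    intro z hz
    by_contra hzK
    have hVo : IsOpen (connectedComponentIn Kᶜ z) := hK.isClosed.isOpen_compl.connectedComponentIn
    have hzV : z ∈ connectedComponentIn Kᶜ z := mem_connectedComponentIn hzK
    obtain ⟨y, hyV, hyU⟩ := mem_closure_iff.mp hz.1 _ hVo hzV
    have e1 := connectedComponentIn_eq hyV
    have e2 := connectedComponentIn_eq hyU
    apply hz.2
    rw [hUo.interior_eq, hU, e2, ← e1]
    exact hzV
  obtain ⟨G, hG⟩ := ContinuousMap.exists_restrict_eq hK.isClosed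
    (⟨K.domRestrict g, continuousOn_iff_continuous_domRestrict.mp hg⟩ : C(K, ℂ))
  have hGg : ∀ z ∈ K, G z = g z := by
    intro z hz
    exact congrArg (fun f => f ⟨z, hz⟩) hG
  obtain ⟨R, hR⟩ := (Metric.isBounded_iff_subset_closedBall p).mp hb
  have hclK : ∀ z ∈ closure U, z ∈ U ∨ z ∈ K := by
    intro z hz
    by_cases h : z ∈ U
    · exact Or.inl h
    · exact Or.inr (hfr ⟨hz, by rwa [hUo.interior_eq]⟩)
  refine no_extension p (max R 0 + 1) (by positivity)
    (fun z => if z ∈ closure U then Complex.exp (G z) * (z - q) else z - p) ?_ ?_ ?_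
  · apply Continuous.if
    · intro a ha
      have haK : a ∈ K := by
        apply hfr
        exact frontier_closure_subset ha
      rw [hGg a haK, hg2 a haK]
      have : a - q ≠ 0 := by
        intro h
        exact hq (by rwa [← sub_eq_zero.mp h])
      field_simp
    · have := G.continuous
      fun_prop
    · fun_prop
  · intro z
    split_ifs with h
    · apply mul_ne_zero (Complex.exp_ne_zero _)
      intro h0
      rw [sub_eq_zero] at h0
      rcases hclK z h with h | h
      · exact hqU (h0 ▸ h)
      · exact hq (h0 ▸ h)
    · intro h0
      rw [sub_eq_zero] at h0
      exact h (subset_closure (h0 ▸ hpU))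
  · intro z hz
    rw [if_neg]
    intro h
    have := closure_minimal hR Metric.isClosed_closedBall h
    rw [Metric.mem_closedBall, dist_eq_norm, hz] at this
    linarith [le_max_left R 0]

/-- Borsuk-type lemma -/
lemma connected_of_exists_log {K : Set ℂ} (hK : IsCompact K) {p q : ℂ} (hp : p ∉ K) (hq : q ∉ K)
    (h : ∃ g : ℂ → ℂ, ContinuousOn g K ∧ ∀ z ∈ K, Complex.exp (g z) = (z - p) / (z - q)) :
    ∃ S : Set ℂ, IsPreconnected S ∧ Disjoint S K ∧ p ∈ S ∧ q ∈ S := by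
  obtain ⟨g, hg, hg2⟩ := h
  by_contra hcon
  have hqU : q ∉ connectedComponentIn Kᶜ p := by
    intro h
    exact hcon ⟨_, isPreconnected_connectedComponentIn,
      Set.disjoint_left.mpr (fun z hz => connectedComponentIn_subset _ _ hz),
      mem_connectedComponentIn hp, h⟩
  have hpV : p ∉ connectedComponentIn Kᶜ q := by
    intro h
    exact hcon ⟨_, isPreconnected_connectedComponentIn,
      Set.disjoint_left.mpr (fun z hz => connectedComponentIn_subset _ _ hz),
      h, mem_connectedComponentIn hq⟩
  have h1 : ¬ Bornology.IsBounded (connectedComponentIn Kᶜ p) := fun hb =>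
    borsuk_bounded hK hp hq g hg hg2 hb hqU
  have h2 : ¬ Bornology.IsBounded (connectedComponentIn Kᶜ q) := fun hb =>
    borsuk_bounded hK hq hp (fun z => - g z) hg.neg
      (fun z hz => by rw [Complex.exp_neg, hg2 z hz, inv_div]) hb hpV
  obtain ⟨R, hR⟩ := (Metric.isBounded_iff_subset_closedBall (0 : ℂ)).mp hK.isBounded
  set R' := max R 0
  have hR' : K ⊆ Metric.closedBall 0 R' :=
    hR.trans (Metric.closedBall_subset_closedBall (le_max_left _ _))
  have hpre := ext_preconnected 0 R' (le_max_right _ _)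
  have hsub : (Metric.closedBall (0 : ℂ) R')ᶜ ⊆ Kᶜ := compl_subset_compl.mpr hR'
  have key : ∀ x, ¬ Bornology.IsBounded (connectedComponentIn Kᶜ x) →
      (Metric.closedBall (0 : ℂ) R')ᶜ ⊆ connectedComponentIn Kᶜ x := by
    intro x hx
    have : ¬ connectedComponentIn Kᶜ x ⊆ Metric.closedBall 0 R' := fun h =>
      hx (Metric.isBounded_closedBall.subset h)
    obtain ⟨y, hy, hy2⟩ := Set.not_subset.mp this
    rw [connectedComponentIn_eq hy]
    exact hpre.subset_connectedComponentIn hy2 hsub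
  have hy : (((R' + 1 : ℝ)) : ℂ) ∈ (Metric.closedBall (0 : ℂ) R')ᶜ := by
    simp only [mem_compl_iff, Metric.mem_closedBall, dist_zero_right, Complex.norm_real,
      Real.norm_eq_abs, not_le]
    exact lt_of_lt_of_le (lt_add_one _) (le_abs_self _)
  have e1 := connectedComponentIn_eq (key p h1 hy)
  have e2 := connectedComponentIn_eq (key q h2 hy)
  apply hqU
  rw [e1, ← e2]
  exact mem_connectedComponentIn hq

/-- the theorem of Janiszewski -/
lemma janiszewski {A B : Set ℂ} (hA : IsCompact A) (hB : IsCompact B)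
    (hAB : IsPreconnected (A ∩ B)) {p q : ℂ}
    (h1 : ∃ S : Set ℂ, IsPreconnected S ∧ Disjoint S A ∧ p ∈ S ∧ q ∈ S)
    (h2 : ∃ S : Set ℂ, IsPreconnected S ∧ Disjoint S B ∧ p ∈ S ∧ q ∈ S) :
    ∃ S : Set ℂ, IsPreconnected S ∧ Disjoint S (A ∪ B) ∧ p ∈ S ∧ q ∈ S := by
  classical
  obtain ⟨S, hS, hSA, hpS, hqS⟩ := h1
  obtain ⟨T, hT, hTB, hpT, hqT⟩ := h2
  have hpA := Set.disjoint_left.mp hSA hpS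
  have hqA := Set.disjoint_left.mp hSA hqS
  have hpB := Set.disjoint_left.mp hTB hpT
  have hqB := Set.disjoint_left.mp hTB hqT
  obtain ⟨g, hg, hg2⟩ := exists_log_of_connected hA hS hSA hpS hqS
  obtain ⟨h, hh, hh2⟩ := exists_log_of_connected hB hT hTB hpT hqT
  have hc : ∃ c : ℂ, Complex.exp c = 1 ∧ ∀ z ∈ A ∩ B, g z = h z + c := by
    rcases (A ∩ B).eq_empty_or_nonempty with he | ⟨x, hx⟩
    · exact ⟨0, by simp, by simp [he]⟩
    · have hexp : ∀ z ∈ A ∩ B, Complex.exp (g z - h z) = 1 := by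
        intro z hz
        rw [Complex.exp_sub, hg2 z hz.1, ← hh2 z hz.2, div_self (Complex.exp_ne_zero _)]
      refine ⟨g x - h x, hexp x hx, ?_⟩
      intro z hz
      have := const_of_exp_eq hAB (fun z => g z - h z)
        ((hg.mono inter_subset_left).sub (hh.mono inter_subset_right)) 1 hexp hx hz
      rw [this]; ring
  obtain ⟨c, hc1, hc2⟩ := hc
  apply connected_of_exists_log (hA.union hB) (by simp [hpA, hpB]) (by simp [hqA, hqB])
  let k : ℂ → ℂ := fun z => if z ∈ A then g z else h z + c
  have kA : ∀ z ∈ A, k z = g z := fun z hz => if_pos hz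
  have kB : ∀ z ∈ B, k z = h z + c := by
    intro z hz
    by_cases hzA : z ∈ A
    · rw [kA z hzA, hc2 z ⟨hzA, hz⟩]
    · exact if_neg hzA
  refine ⟨k, ?_, ?_⟩
  · apply ContinuousOn.union_of_isClosed _ _ hA.isClosed hB.isClosed
    · exact hg.congr kA
    · exact (hh.add continuousOn_const).congr kB
  · rintro z (hz | hz)
    · rw [kA z hz, hg2 z hz]
    · rw [kB z hz, Complex.exp_add, hc1, mul_one, hh2 z hz]

open MeasureTheory in
lemma area_lintegral (D : Set ℂ) (hD : IsOpen D) (ψ : ℂ → ℂ) (hψ : DifferentiableOn ℂ ψ D)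
    (hinj : InjOn ψ D) :
    ∫⁻ w in D, ‖deriv ψ w‖ₑ ^ 2 = volume (ψ '' D) := by
  have h := lintegral_image_eq_lintegral_abs_det_fderiv_mul volume hD.measurableSet
    (f := ψ) (f' := fun w => ((ContinuousLinearMap.toSpanSingleton ℂ (deriv ψ w)).restrictScalars ℝ))
    (fun w hw => by
      have h1 := (hψ.differentiableAt (hD.mem_nhds hw)).hasDerivAt.hasFDerivAt
      exact (h1.restrictScalars ℝ).hasFDerivWithinAt) hinj (fun _ => 1)
  simp only [lintegral_one, Measure.restrict_apply MeasurableSet.univ, univ_inter, mul_one] at h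
  rw [h]
  apply lintegral_congr
  intro w
  have : ((ContinuousLinearMap.toSpanSingleton ℂ (deriv ψ w)).restrictScalars ℝ).det
      = ‖deriv ψ w‖ ^ 2 := by
    simp [ContinuousLinearMap.det, LinearMap.det_restrictScalars, Algebra.norm_complex_apply,
      Complex.normSq_eq_norm_sq]
  rw [this, abs_of_nonneg (by positivity), ENNReal.ofReal_pow (norm_nonneg _), ofReal_norm]

open MeasureTheory in
lemma cs_lintegral {α : Type*} [MeasurableSpace α] (μ : Measure α) (F : α → ENNReal)
    (hF : AEMeasurable F μ) : (∫⁻ a, F a ∂μ) ^ 2 ≤ (∫⁻ a, F a ^ 2 ∂μ) * μ univ := by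
  have h := ENNReal.lintegral_mul_le_Lp_mul_Lq μ Real.HolderConjugate.two_two hF
    (aemeasurable_const (b := (1 : ENNReal)))
  have h2 := pow_le_pow_left' h 2
  simp only [Pi.mul_apply, mul_one, mul_pow, ENNReal.one_rpow, lintegral_const, one_mul] at h2
  refine h2.trans (le_of_eq ?_)
  rw [← ENNReal.rpow_natCast, ← ENNReal.rpow_mul, ← ENNReal.rpow_natCast, ← ENNReal.rpow_mul]
  norm_num

lemma mem_ball_polar (r θ : ℝ) (hr : 0 < r) :
    (r : ℂ) * Complex.exp (θ * Complex.I) ∈ Metric.ball (1 : ℂ) 1 ↔ r < 2 * Real.cos θ := by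
  rw [Metric.mem_ball, dist_eq_norm, ← sq_lt_one_iff₀ (norm_nonneg _), ← Complex.normSq_eq_norm_sq,
    Complex.normSq_apply]
  have hre : ((r : ℂ) * Complex.exp (θ * Complex.I) - 1).re = r * Real.cos θ - 1 := by
    simp [Complex.exp_ofReal_mul_I_re]
  have him : ((r : ℂ) * Complex.exp (θ * Complex.I) - 1).im = r * Real.sin θ := by
    simp [Complex.exp_ofReal_mul_I_im]
  rw [hre, him]
  have := Real.sin_sq_add_cos_sq θ
  have e : (r * Real.cos θ - 1) * (r * Real.cos θ - 1) + r * Real.sin θ * (r * Real.sin θ)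
     = 1 + r * (r - 2 * Real.cos θ) := by linear_combination r ^ 2 * this
  rw [e]
  constructor
  · intro h
    nlinarith
  · intro h
    nlinarith

open MeasureTheory in
lemma arc_dist_le (ψ : ℂ → ℂ) (hψ : DifferentiableOn ℂ ψ (Metric.ball 1 1)) (r s t : ℝ)
    (hr : 0 < r) (hst : s ≤ t) (hs : s ∈ Ioo (-Real.pi) Real.pi) (ht : t ∈ Ioo (-Real.pi) Real.pi)
    (hsD : (r : ℂ) * Complex.exp (s * Complex.I) ∈ Metric.ball (1 : ℂ) 1)
    (htD : (r : ℂ) * Complex.exp (t * Complex.I) ∈ Metric.ball (1 : ℂ) 1) :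
    edist (ψ (r * Complex.exp (s * Complex.I))) (ψ (r * Complex.exp (t * Complex.I))) ≤
    ∫⁻ θ in Ioo (-Real.pi) Real.pi, ENNReal.ofReal r *
      (Metric.ball (1 : ℂ) 1).indicator (fun w => ‖deriv ψ w‖ₑ)
        ((r : ℂ) * Complex.exp (θ * Complex.I)) := by
  have hin : ∀ θ ∈ Icc s t, (r : ℂ) * Complex.exp (θ * Complex.I) ∈ Metric.ball (1 : ℂ) 1 := by
    intro θ hθ
    rw [mem_ball_polar _ _ hr] at *
    have key : ∀ x : ℝ, x ∈ Ioo (-Real.pi) Real.pi → |θ| ≤ |x| → Real.cos x ≤ Real.cos θ := by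
      intro x hx hle
      rw [← Real.cos_abs x, ← Real.cos_abs θ]
      exact Real.cos_le_cos_of_nonneg_of_le_pi (abs_nonneg _) (abs_le.mpr ⟨hx.1.le, hx.2.le⟩) hle
    rcases le_total 0 θ with h0 | h0
    · have := key t ht (by rw [abs_of_nonneg h0]; exact hθ.2.trans (le_abs_self _))
      linarith
    · have := key s hs (by
        rw [abs_of_nonpos h0]; exact (neg_le_neg hθ.1).trans (neg_le_abs _))
      linarith
  have hder : ∀ θ ∈ uIcc s t, HasDerivAt (fun θ : ℝ => ψ (r * Complex.exp (θ * Complex.I)))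
      (deriv ψ (r * Complex.exp (θ * Complex.I)) * (r * (Complex.exp (θ * Complex.I) * Complex.I))) θ := by
    intro θ hθ
    rw [uIcc_of_le hst] at hθ
    have h1 := (hψ.differentiableAt (Metric.isOpen_ball.mem_nhds (hin θ hθ))).hasDerivAt
    have h2 : HasDerivAt (fun θ : ℝ => (r : ℂ) * Complex.exp (θ * Complex.I))
        (r * (Complex.exp (θ * Complex.I) * Complex.I)) θ := by
      have h3 : HasDerivAt (fun θ : ℝ => (θ : ℂ) * Complex.I) Complex.I θ := by
        simpa using (Complex.ofRealCLM.hasDerivAt (x := θ)).mul_const Complex.I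
      exact (h3.cexp).const_mul _
    exact h1.comp θ h2
  have hdc : ContinuousOn (deriv ψ) (Metric.ball 1 1) :=
    (hψ.deriv Metric.isOpen_ball).continuousOn
  have hcont : ContinuousOn (fun θ : ℝ => deriv ψ (r * Complex.exp (θ * Complex.I)) *
      (r * (Complex.exp (θ * Complex.I) * Complex.I))) (uIcc s t) := by
    rw [uIcc_of_le hst]
    apply ContinuousOn.mul _ (by fun_prop)
    exact hdc.comp (by fun_prop) hin
  have hval := intervalIntegral.integral_eq_sub_of_hasDerivAt hder hcont.intervalIntegrable
  rw [edist_comm, edist_eq_enorm_sub, ← hval, intervalIntegral.integral_of_le hst]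
  refine (enorm_integral_le_lintegral_enorm _).trans ?_
  calc _ ≤ ∫⁻ θ in Ioc s t, ENNReal.ofReal r *
      (Metric.ball (1 : ℂ) 1).indicator (fun w => ‖deriv ψ w‖ₑ)
        ((r : ℂ) * Complex.exp (θ * Complex.I)) := by
        apply setLIntegral_mono_ae' measurableSet_Ioc
        filter_upwards with θ hθ
        rw [indicator_of_mem (hin θ ⟨hθ.1.le, hθ.2⟩)]
        have e1 : ‖Complex.exp (θ * Complex.I)‖ₑ = 1 := by
          rw [← ofReal_norm, Complex.norm_exp_ofReal_mul_I]; simp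
        have e2 : ‖Complex.I‖ₑ = 1 := by rw [← ofReal_norm]; simp
        have e3 : ‖(r : ℂ)‖ₑ = ENNReal.ofReal r := by
          rw [← ofReal_norm, Complex.norm_real, Real.norm_of_nonneg hr.le]
        rw [enorm_mul, enorm_mul, enorm_mul, e1, e2, e3, mul_one, mul_one, mul_comm]
    _ ≤ _ := by
        apply lintegral_mono_set
        intro θ hθ
        exact ⟨hs.1.trans hθ.1, lt_of_le_of_lt hθ.2 ht.2⟩

open MeasureTheory in
lemma wolff (ψ : ℂ → ℂ) (hψ : DifferentiableOn ℂ ψ (Metric.ball 1 1))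
    (hinj : InjOn ψ (Metric.ball 1 1)) (hb : Bornology.IsBounded (ψ '' Metric.ball 1 1))
    (δ : ℝ) (hδ : 0 < δ) (R : ℝ) (hR : 0 < R) :
    ∃ r, 0 < r ∧ r < R ∧ ∀ w ∈ Metric.ball (1 : ℂ) 1, ∀ w' ∈ Metric.ball (1 : ℂ) 1,
      ‖w‖ = r → ‖w'‖ = r → dist (ψ w) (ψ w') ≤ δ := by
  by_contra hcon
  push Not at hcon
  set F : ℂ → ENNReal := (Metric.ball (1 : ℂ) 1).indicator (fun w => ‖deriv ψ w‖ₑ) with hF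
  have hFm : Measurable F := (measurable_deriv ψ).enorm.indicator measurableSet_ball
  have hfin : ∫⁻ w, F w ^ 2 < ⊤ := by
    have h1 : ∀ w, F w ^ 2 = (Metric.ball (1 : ℂ) 1).indicator (fun w => ‖deriv ψ w‖ₑ ^ 2) w := by
      intro w
      by_cases hw : w ∈ Metric.ball (1 : ℂ) 1
      · simp [hF, indicator_of_mem hw]
      · simp [hF, indicator_of_notMem hw]
    simp_rw [h1]
    rw [lintegral_indicator measurableSet_ball, area_lintegral _ Metric.isOpen_ball _ hψ hinj]
    exact hb.measure_lt_top
  rw [← Complex.lintegral_comp_polarCoord_symm] at hfin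
  have hsymm : ∀ p : ℝ × ℝ, Complex.polarCoord.symm p = p.1 * Complex.exp (p.2 * Complex.I) := by
    intro p
    rw [Complex.polarCoord_symm_apply, Complex.exp_mul_I]
    simp
  simp_rw [hsymm] at hfin
  rw [polarCoord_target, Measure.volume_eq_prod, ← Measure.prod_restrict, lintegral_prod] at hfin
  swap
  · apply Measurable.aemeasurable
    simp only [smul_eq_mul]
    exact Measurable.mul (by fun_prop) ((hFm.comp (by fun_prop)).pow_const 2)
  simp only [smul_eq_mul] at hfin
  set H : ℝ → ENNReal := fun r => ∫⁻ θ in Ioo (-Real.pi) Real.pi,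
    ENNReal.ofReal r * F (r * Complex.exp (θ * Complex.I)) ^ 2 with hH
  have hFr : ∀ r : ℝ, Measurable (fun θ : ℝ => F (r * Complex.exp (θ * Complex.I))) :=
    fun r => hFm.comp (by fun_prop)
  have hlow : ∀ r ∈ Ioo 0 R, ENNReal.ofReal (δ ^ 2) * ENNReal.ofReal r⁻¹ ≤
      H r * ENNReal.ofReal (2 * Real.pi) := by
    intro r hr
    obtain ⟨w, hw, w', hw', hwr, hwr', hdist⟩ := hcon r hr.1 hr.2
    have harg : ∀ w ∈ Metric.ball (1 : ℂ) 1, ‖w‖ = r → w.arg ∈ Ioo (-Real.pi) Real.pi ∧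
        w = r * Complex.exp (w.arg * Complex.I) := by
      intro w hw hwr
      refine ⟨⟨Complex.neg_pi_lt_arg w, ?_⟩, ?_⟩
      · apply lt_of_le_of_ne (Complex.arg_le_pi w)
        intro h
        have := (Complex.arg_eq_pi_iff.mp h).1
        rw [Metric.mem_ball, dist_eq_norm] at hw
        have h2 := (Complex.abs_re_le_norm (w - 1)).trans_lt hw
        rw [abs_lt] at h2
        simp at h2
        linarith
      · rw [← hwr, Complex.norm_mul_exp_arg_mul_I]
    obtain ⟨ha, hea⟩ := harg w hw hwr
    obtain ⟨ha', hea'⟩ := harg w' hw' hwr'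
    have hL : ENNReal.ofReal δ ≤ ∫⁻ θ in Ioo (-Real.pi) Real.pi, ENNReal.ofReal r *
        F (r * Complex.exp (θ * Complex.I)) := by
      have h1 : ENNReal.ofReal δ ≤ edist (ψ w) (ψ w') := by
        rw [edist_dist]
        exact ENNReal.ofReal_le_ofReal hdist.le
      refine h1.trans ?_
      rcases le_total w.arg w'.arg with hle | hle
      · have := arc_dist_le ψ hψ r _ _ hr.1 hle ha ha' (hea ▸ hw) (hea' ▸ hw')
        rwa [← hea, ← hea'] at this
      · have := arc_dist_le ψ hψ r _ _ hr.1 hle ha' ha (hea' ▸ hw') (hea ▸ hw)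
        rwa [← hea, ← hea', edist_comm] at this
    have hcs := cs_lintegral (volume.restrict (Ioo (-Real.pi) Real.pi))
      (fun θ : ℝ => F (r * Complex.exp (θ * Complex.I))) (hFr r).aemeasurable
    rw [Measure.restrict_apply MeasurableSet.univ, univ_inter, Real.volume_Ioo] at hcs
    rw [lintegral_const_mul _ (hFr r)] at hL
    have hL2 := pow_le_pow_left' hL 2
    rw [mul_pow] at hL2
    have hr0 : ENNReal.ofReal r ≠ 0 := by simp [hr.1]
    have hrt : ENNReal.ofReal r ≠ ⊤ := ENNReal.ofReal_ne_top
    simp only [hH]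
    rw [lintegral_const_mul _ ((hFr r).pow_const 2), ENNReal.ofReal_pow hδ.le,
      ENNReal.ofReal_inv_of_pos hr.1]
    calc _ ≤ (ENNReal.ofReal r ^ 2 * (∫⁻ θ in Ioo (-Real.pi) Real.pi,
          F (r * Complex.exp (θ * Complex.I))) ^ 2) * (ENNReal.ofReal r)⁻¹ := by gcongr
      _ ≤ (ENNReal.ofReal r ^ 2 * ((∫⁻ θ in Ioo (-Real.pi) Real.pi,
          F (r * Complex.exp (θ * Complex.I)) ^ 2) *
            ENNReal.ofReal (Real.pi - -Real.pi))) * (ENNReal.ofReal r)⁻¹ := by gcongr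
      _ = (ENNReal.ofReal r * (ENNReal.ofReal r)⁻¹) * (ENNReal.ofReal r *
          (∫⁻ θ in Ioo (-Real.pi) Real.pi,
          F (r * Complex.exp (θ * Complex.I)) ^ 2) * ENNReal.ofReal (Real.pi - -Real.pi)) := by ring
      _ = _ := by
        rw [ENNReal.mul_inv_cancel hr0 hrt, one_mul]
        congr 2
        ring
  have hni : ¬ IntervalIntegrable (fun x : ℝ => x⁻¹) volume 0 R := by
    rw [intervalIntegrable_inv_iff]
    simp [hR.ne]
  apply hni
  rw [intervalIntegrable_iff_integrableOn_Ioo_of_le hR.le]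
  refine ⟨measurable_inv.aestronglyMeasurable, ?_⟩
  rw [hasFiniteIntegral_iff_enorm]
  have h3 : ENNReal.ofReal (δ ^ 2) * ∫⁻ a in Ioo 0 R, ‖a⁻¹‖ₑ < ⊤ := by
    rw [← lintegral_const_mul _ (by fun_prop)]
    calc _ ≤ ∫⁻ r in Ioo 0 R, H r * ENNReal.ofReal (2 * Real.pi) := by
          apply setLIntegral_mono_ae' measurableSet_Ioo
          filter_upwards with r hr
          have : ‖r⁻¹‖ₑ = ENNReal.ofReal r⁻¹ := Real.enorm_of_nonneg (inv_nonneg.mpr hr.1.le)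
          rw [this]
          exact hlow r hr
      _ ≤ ∫⁻ r in Ioi 0, H r * ENNReal.ofReal (2 * Real.pi) :=
          lintegral_mono_set Ioo_subset_Ioi_self
      _ = (∫⁻ r in Ioi 0, H r) * ENNReal.ofReal (2 * Real.pi) :=
          lintegral_mul_const' _ _ ENNReal.ofReal_ne_top
      _ < ⊤ := ENNReal.mul_lt_top hfin ENNReal.ofReal_lt_top
  by_contra htop
  rw [not_lt, top_le_iff] at htop
  rw [htop, ENNReal.mul_top (by simp [hδ.ne'])] at h3
  exact lt_irrefl _ h3

lemma open_image (φ : ℂ → ℂ) (hφd : DifferentiableOn ℂ φ (Metric.ball 0 1))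
    (hinj : InjOn φ (Metric.ball 0 1)) (s : Set ℂ) (hs : s ⊆ Metric.ball 0 1) (hso : IsOpen s) :
    IsOpen (φ '' s) := by
  have han : AnalyticOnNhd ℂ φ (Metric.ball 0 1) := hφd.analyticOnNhd Metric.isOpen_ball
  rcases han.is_constant_or_isOpen (convex_ball (0 : ℂ) 1).isPreconnected with ⟨w, hw⟩ | h
  · exfalso
    have h0 : (0 : ℂ) ∈ Metric.ball (0 : ℂ) 1 := by simp
    have h1 : (1 / 2 : ℂ) ∈ Metric.ball (0 : ℂ) 1 := by simp; norm_num
    have := hinj h0 h1 ((hw _ h0).trans (hw _ h1).symm)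
    norm_num at this
  · exact h s hs hso

lemma exists_inverse (G : Set ℂ) (φ : ℂ → ℂ) (hφd : DifferentiableOn ℂ φ (Metric.ball 0 1))
    (hφb : Set.BijOn φ (Metric.ball 0 1) G) :
    ∃ g : ℂ → ℂ, ContinuousOn g G ∧ (∀ z ∈ Metric.ball (0 : ℂ) 1, g (φ z) = z) ∧
      ∀ w ∈ G, g w ∈ Metric.ball (0 : ℂ) 1 ∧ φ (g w) = w := by
  have hinv := hφb.invOn_invFunOn
  have hmaps : ∀ w ∈ G, Function.invFunOn φ (Metric.ball 0 1) w ∈ Metric.ball (0 : ℂ) 1 :=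
    fun w hw => Function.invFunOn_mem (hφb.surjOn hw)
  refine ⟨Function.invFunOn φ (Metric.ball 0 1), ?_, fun z hz => hinv.1 hz,
    fun w hw => ⟨hmaps w hw, hinv.2 hw⟩⟩
  intro w hw
  rw [ContinuousWithinAt, tendsto_def]
  intro N hN
  obtain ⟨O, hON, hO, hwO⟩ := mem_nhds_iff.mp hN
  have hop := open_image φ hφd hφb.injOn (O ∩ Metric.ball 0 1) inter_subset_right
    (hO.inter Metric.isOpen_ball)
  apply mem_nhdsWithin_of_mem_nhds
  refine mem_of_superset (hop.mem_nhds ⟨_, ⟨hwO, hmaps w hw⟩, hinv.2 hw⟩) ?_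
  rintro _ ⟨z, ⟨hz, hzb⟩, rfl⟩
  apply hON
  rw [hinv.1 hzb]
  exact hz

/-- pull back a connected set avoiding the boundary -/
lemma pull_back (G : Set ℂ) (hGo : IsOpen G) (φ : ℂ → ℂ)
    (hφd : DifferentiableOn ℂ φ (Metric.ball 0 1))
    (hφb : Set.BijOn φ (Metric.ball 0 1) G) (S : Set ℂ) (hS : IsPreconnected S)
    (hSf : Disjoint S (frontier G)) (u v : ℂ) (hu : u ∈ Metric.ball (0 : ℂ) 1)
    (hv : v ∈ Metric.ball (0 : ℂ) 1) (huS : φ u ∈ S) (hvS : φ v ∈ S) :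
    ∃ S' : Set ℂ, IsPreconnected S' ∧ S' ⊆ Metric.ball 0 1 ∧ u ∈ S' ∧ v ∈ S' ∧
      ∀ x ∈ S', φ x ∈ S := by
  obtain ⟨g, hgc, hg1, hg2⟩ := exists_inverse G φ hφd hφb
  have hSG : S ⊆ G := by
    apply hS.subset_of_closure_inter_subset hGo ⟨φ u, huS, hφb.mapsTo hu⟩
    rintro z ⟨hz, hzS⟩
    by_contra hzG
    exact Set.disjoint_left.mp hSf hzS ⟨hz, by rwa [hGo.interior_eq]⟩
  refine ⟨g '' S, hS.image g (hgc.mono hSG), ?_, ⟨_, huS, hg1 u hu⟩, ⟨_, hvS, hg1 v hv⟩, ?_⟩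
  · rintro _ ⟨x, hx, rfl⟩
    exact (hg2 x (hSG hx)).1
  · rintro _ ⟨x, hx, rfl⟩
    rwa [(hg2 x (hSG hx)).2]

/-- uniform local connectedness of a Jordan curve -/
lemma jordan_ulc (p : ℂ → ℂ) (hp : ContinuousOn p (Metric.sphere 0 1))
    (hinj : InjOn p (Metric.sphere 0 1)) (η : ℝ) (hη : 0 < η) :
    ∃ δ > 0, ∀ T ⊆ p '' Metric.sphere 0 1, (∀ x ∈ T, ∀ y ∈ T, dist x y ≤ δ) →
      ∃ B, IsCompact B ∧ IsPreconnected B ∧ T ⊆ B ∧ B ⊆ p '' Metric.sphere 0 1 ∧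
        ∀ x ∈ B, ∃ t ∈ T, dist x t ≤ η := by
  have hcomp : IsCompact (Metric.sphere (0 : ℂ) 1) := isCompact_sphere 0 1
  have huc := hcomp.uniformContinuousOn_of_continuous hp
  obtain ⟨η1, hη1, h1⟩ := Metric.uniformContinuousOn_iff.mp huc η hη
  have harg : ContinuousAt Complex.arg 1 := Complex.continuousAt_arg (by simp)
  obtain ⟨η2, hη2, h2⟩ := Metric.continuousAt_iff.mp harg (η1 / 2) (by positivity)
  have hK : IsCompact ((Metric.sphere (0 : ℂ) 1 ×ˢ Metric.sphere (0 : ℂ) 1) ∩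
      {x : ℂ × ℂ | η2 ≤ dist x.1 x.2}) :=
    (hcomp.prod hcomp).inter_right (isClosed_le continuous_const (by fun_prop))
  have hfc : ContinuousOn (fun x : ℂ × ℂ => dist (p x.1) (p x.2))
      ((Metric.sphere (0 : ℂ) 1 ×ˢ Metric.sphere (0 : ℂ) 1) ∩
      {x : ℂ × ℂ | η2 ≤ dist x.1 x.2}) := by
    refine continuous_dist.comp_continuousOn (ContinuousOn.prodMk ?_ ?_)
    · exact hp.comp continuousOn_fst (fun x hx => hx.1.1)
    · exact hp.comp continuousOn_snd (fun x hx => hx.1.2)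
  obtain ⟨δ, hδ, hmin⟩ := hK.exists_forall_le' (a := 0) hfc (by
    rintro ⟨x, y⟩ ⟨⟨hx, hy⟩, hxy⟩
    simp only [mem_ofPred_eq] at hxy hx hy ⊢
    rw [dist_pos]
    intro h
    rw [hinj hx hy h, dist_self] at hxy
    linarith)
  refine ⟨δ / 2, by positivity, ?_⟩
  intro T hT hTd
  rcases T.eq_empty_or_nonempty with rfl | ⟨x0, hx0⟩
  · exact ⟨∅, isCompact_empty, isPreconnected_empty, by simp, by simp, by simp⟩
  obtain ⟨c0, hc0, rfl⟩ := hT hx0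
  have hc0n : ‖c0‖ = 1 := by simpa using hc0
  have hc00 : c0 ≠ 0 := by rintro rfl; simp at hc0n
  have hmap : ∀ θ : ℝ, c0 * Complex.exp (θ * Complex.I) ∈ Metric.sphere (0 : ℂ) 1 := by
    intro θ
    simp [hc0n]
  have hcur : ContinuousOn (fun θ : ℝ => p (c0 * Complex.exp (θ * Complex.I)))
      (Icc (-(η1 / 2)) (η1 / 2)) :=
    hp.comp (by fun_prop) (fun θ _ => hmap θ)
  refine ⟨(fun θ : ℝ => p (c0 * Complex.exp (θ * Complex.I))) '' Icc (-(η1 / 2)) (η1 / 2),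
    isCompact_Icc.image_of_continuousOn hcur, isPreconnected_Icc.image _ hcur, ?_, ?_, ?_⟩
  · intro y hy
    obtain ⟨c, hc, rfl⟩ := hT hy
    have hcn : ‖c‖ = 1 := by simpa using hc
    have hd : dist c c0 < η2 := by
      by_contra hge
      push Not at hge
      have := hmin (c, c0) ⟨⟨hc, hc0⟩, hge⟩
      have := hTd _ hy _ hx0
      simp only at *
      linarith
    have hd2 : dist (c / c0) 1 < η2 := by
      rw [dist_eq_norm] at hd ⊢
      have : c / c0 - 1 = (c - c0) / c0 := by field_simp
      rw [this, norm_div, hc0n, div_one]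
      exact hd
    have h3 := h2 hd2
    rw [Complex.arg_one, Real.dist_eq, sub_zero, abs_lt] at h3
    refine ⟨(c / c0).arg, ⟨h3.1.le, h3.2.le⟩, ?_⟩
    have h4 := Complex.norm_mul_exp_arg_mul_I (c / c0)
    rw [norm_div, hcn, hc0n] at h4
    simp only [div_one, Complex.ofReal_one, one_mul] at h4
    simp only [h4]
    congr 1
    field_simp
  · rintro _ ⟨θ, -, rfl⟩
    exact ⟨_, hmap θ, rfl⟩
  · rintro _ ⟨θ, hθ, rfl⟩
    refine ⟨_, hx0, ?_⟩
    refine (h1 _ (hmap θ) _ hc0 ?_).le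
    rw [dist_eq_norm]
    have e : c0 * Complex.exp (θ * Complex.I) - c0 = c0 * (Complex.exp (Complex.I * θ) - 1) := by
      rw [mul_comm Complex.I]; ring
    rw [e, norm_mul, hc0n, one_mul]
    refine (Real.norm_exp_I_mul_ofReal_sub_one_le).trans_lt ?_
    rw [Real.norm_eq_abs]
    have := abs_le.mpr ⟨hθ.1, hθ.2⟩
    linarith

/-- length-area estimate transported to a boundary point -/
lemma wolff_at (G : Set ℂ) (hGb : Bornology.IsBounded G) (φ : ℂ → ℂ)
    (hφd : DifferentiableOn ℂ φ (Metric.ball 0 1))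
    (hφb : Set.BijOn φ (Metric.ball 0 1) G) (ζ : ℂ) (hζ : ‖ζ‖ = 1)
    (δ : ℝ) (hδ : 0 < δ) (R : ℝ) (hR : 0 < R) :
    ∃ r, 0 < r ∧ r < R ∧ ∀ u ∈ Metric.ball (0 : ℂ) 1, ∀ u' ∈ Metric.ball (0 : ℂ) 1,
      ‖u - ζ‖ = r → ‖u' - ζ‖ = r → dist (φ u) (φ u') ≤ δ := by
  have hζ0 : ζ ≠ 0 := by rintro rfl; simp at hζ
  have hmaps : MapsTo (fun w => ζ * (1 - w)) (Metric.ball (1 : ℂ) 1) (Metric.ball 0 1) := by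
    intro w hw
    rw [Metric.mem_ball, dist_eq_norm] at hw
    simp only [Metric.mem_ball, dist_zero_right, norm_mul, hζ, one_mul]
    rwa [norm_sub_rev]
  obtain ⟨r, hr0, hrR, h⟩ := wolff (fun w => φ (ζ * (1 - w)))
    (hφd.comp (by fun_prop) hmaps)
    (by
      intro x hx y hy hxy
      have := hφb.injOn (hmaps hx) (hmaps hy) hxy
      have := mul_left_cancel₀ hζ0 this
      linear_combination -this)
    (hGb.subset (by
      rintro _ ⟨w, hw, rfl⟩
      exact hφb.mapsTo (hmaps hw))) δ hδ R hR
  refine ⟨r, hr0, hrR, ?_⟩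
  intro u hu u' hu' hur hur'
  have key : ∀ u ∈ Metric.ball (0 : ℂ) 1, ‖u - ζ‖ = r → (1 - u / ζ) ∈ Metric.ball (1 : ℂ) 1 ∧
      ‖1 - u / ζ‖ = r ∧ ζ * (1 - (1 - u / ζ)) = u := by
    intro u hu hur
    refine ⟨?_, ?_, ?_⟩
    · rw [Metric.mem_ball, dist_eq_norm]
      simpa [hζ] using hu
    · have : 1 - u / ζ = -((u - ζ) / ζ) := by field_simp; ring
      rw [this, norm_neg, norm_div, hζ, hur, div_one]
    · field_simp; ring
  obtain ⟨a1, a2, a3⟩ := key u hu hur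
  obtain ⟨b1, b2, b3⟩ := key u' hu' hur'
  have := h _ a1 _ b1 a2 b2
  simp only [a3, b3] at this
  exact this

/-- oscillation at a boundary point tends to zero -/
lemma small_osc (G : Set ℂ) (hGo : IsOpen G) (hGb : Bornology.IsBounded G)
    (φ : ℂ → ℂ) (hφd : DifferentiableOn ℂ φ (Metric.ball 0 1))
    (hφb : Set.BijOn φ (Metric.ball 0 1) G)
    (p : ℂ → ℂ) (hp : ContinuousOn p (Metric.sphere 0 1))
    (hinj : InjOn p (Metric.sphere 0 1)) (hpG : p '' Metric.sphere 0 1 = frontier G)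
    (ζ : ℂ) (hζ : ‖ζ‖ = 1) (ε : ℝ) (hε : 0 < ε) :
    ∃ r > 0, ∀ u ∈ Metric.ball (0 : ℂ) 1, ∀ u' ∈ Metric.ball (0 : ℂ) 1,
      ‖u - ζ‖ < r → ‖u' - ζ‖ < r → dist (φ u) (φ u') ≤ ε := by
  have h00 : (0 : ℂ) ∈ Metric.ball (0 : ℂ) 1 := by simp
  have hop := open_image φ hφd hφb.injOn (Metric.ball 0 (1 / 2))
    (Metric.ball_subset_ball (by norm_num)) Metric.isOpen_ball
  obtain ⟨m, hm, hmball⟩ := Metric.isOpen_iff.mp hop (φ 0) ⟨0, by simp, rfl⟩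
  have hfar : ∀ u ∈ Metric.ball (0 : ℂ) 1, 1 / 2 ≤ ‖u‖ → m ≤ dist (φ u) (φ 0) := by
    intro u hu hun
    by_contra hlt
    push Not at hlt
    obtain ⟨v, hv, hvu⟩ := hmball (Metric.mem_ball.mpr hlt)
    have : v = u := hφb.injOn (Metric.ball_subset_ball (by norm_num) hv) hu hvu
    rw [this, Metric.mem_ball, dist_zero_right] at hv
    linarith
  set η := min ε m / 4 with hη
  have hηpos : 0 < η := by positivity
  have hηε : 4 * η ≤ ε := by have := min_le_left ε m; linarith
  have hηm : 4 * η ≤ m := by have := min_le_right ε m; linarith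
  obtain ⟨δ0, hδ0, hulc⟩ := jordan_ulc p hp hinj η hηpos
  obtain ⟨r, hr0, hr2, hr⟩ := wolff_at G hGb φ hφd hφb ζ hζ (min δ0 η) (by positivity) (1 / 2)
    (by norm_num)
  have hfrc : IsCompact (frontier G) := by
    rw [← hpG]; exact (isCompact_sphere _ _).image_of_continuousOn hp
  set arc := φ '' (Metric.ball 0 1 ∩ Metric.sphere ζ r) with harc
  have hCG : arc ⊆ G := by
    rintro _ ⟨u, hu, rfl⟩
    exact hφb.mapsTo hu.1
  have hCcomp : IsCompact (closure arc) := (hGb.subset hCG).isCompact_closure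
  -- base point
  have hbase : ζ * (1 - r) ∈ Metric.ball (0 : ℂ) 1 ∩ Metric.sphere ζ r ∧ 1 / 2 ≤ ‖ζ * (1 - r)‖ := by
    have hn : ‖ζ * (1 - r)‖ = 1 - r := by
      rw [norm_mul, hζ, one_mul]
      have : ((1 : ℂ) - r) = ((1 - r : ℝ) : ℂ) := by push_cast; ring
      rw [this, Complex.norm_real, Real.norm_of_nonneg (by linarith)]
    refine ⟨⟨?_, ?_⟩, by rw [hn]; linarith⟩
    · rw [Metric.mem_ball, dist_zero_right, hn]; linarith
    · rw [Metric.mem_sphere, dist_eq_norm]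
      have : ζ * (1 - r) - ζ = -(ζ * r) := by ring
      rw [this, norm_neg, norm_mul, hζ, one_mul, Complex.norm_real, Real.norm_of_nonneg hr0.le]
  set x1 := φ (ζ * (1 - r)) with hx1
  have hx1arc : x1 ∈ arc := ⟨_, hbase.1, rfl⟩
  have hdiam : ∀ x ∈ closure arc, ∀ y ∈ closure arc, dist x y ≤ min δ0 η := by
    have h1 : ∀ x ∈ arc, ∀ y ∈ arc, dist x y ≤ min δ0 η := by
      rintro _ ⟨u, hu, rfl⟩ _ ⟨v, hv, rfl⟩
      exact hr u hu.1 v hv.1 (by simpa [dist_eq_norm] using hu.2)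
        (by simpa [dist_eq_norm] using hv.2)
    have h2 : closure (arc ×ˢ arc) ⊆ {x : ℂ × ℂ | dist x.1 x.2 ≤ min δ0 η} :=
      closure_minimal (fun x hx => h1 _ hx.1 _ hx.2) (isClosed_le (by fun_prop) continuous_const)
    intro x hx y hy
    exact h2 (by rw [closure_prod_eq]; exact ⟨hx, hy⟩ : (x, y) ∈ closure (arc ×ˢ arc))
  obtain ⟨B, hBc, hBconn, hTB, hBJ, hBT⟩ := hulc (closure arc ∩ frontier G)
    (by rw [hpG]; exact inter_subset_right)
    (fun x hx y hy => (hdiam x hx.1 y hy.1).trans (min_le_left _ _))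
  rw [hpG] at hBJ
  have hK1 : closure arc ∪ B ⊆ Metric.closedBall x1 (2 * η) := by
    rintro x (hx | hx)
    · have := (hdiam x hx x1 (subset_closure hx1arc)).trans (min_le_right _ _)
      rw [Metric.mem_closedBall]; linarith
    · obtain ⟨t, ht, hxt⟩ := hBT x hx
      have := (hdiam t ht.1 x1 (subset_closure hx1arc)).trans (min_le_right _ _)
      have := dist_triangle x t x1
      rw [Metric.mem_closedBall]; linarith
  have hinter : (closure arc ∪ B) ∩ frontier G = B := by
    ext x
    constructor
    · rintro ⟨hx | hx, hf⟩
      · exact hTB ⟨hx, hf⟩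
      · exact hx
    · intro hx
      exact ⟨Or.inr hx, hBJ hx⟩
  have hφ0 : φ 0 ∈ (Metric.closedBall x1 (2 * η))ᶜ := by
    rw [mem_compl_iff, Metric.mem_closedBall, not_le, dist_comm]
    have := hfar _ hbase.1.1 hbase.2
    linarith
  have hfrG : Disjoint G (frontier G) := by
    rw [Set.disjoint_left]
    intro x hx hf
    exact hf.2 (by rwa [hGo.interior_eq])
  have hGpre : IsPreconnected G := by
    rw [← hφb.image_eq]
    exact (convex_ball (0 : ℂ) 1).isPreconnected.image φ hφd.continuousOn
  have hmain : ∀ u ∈ Metric.ball (0 : ℂ) 1, ‖u - ζ‖ < r →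
      φ u ∈ Metric.closedBall x1 (2 * η) := by
    intro u hu hur
    by_contra hnot
    obtain ⟨S, hS, hSK, huS, h0S⟩ := janiszewski (A := closure arc ∪ B) (B := frontier G)
      (p := φ u) (q := φ 0) (hCcomp.union hBc) hfrc (by rw [hinter]; exact hBconn)
      ⟨_, ext_preconnected x1 (2 * η) (by positivity),
        disjoint_compl_left.mono_right hK1, hnot, hφ0⟩
      ⟨G, hGpre, hfrG, hφb.mapsTo hu, hφb.mapsTo h00⟩
    obtain ⟨S', hS', hS'b, huS', h0S', hS'S⟩ := pull_back G hGo φ hφd hφb S hS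
      (hSK.mono_right subset_union_right) u 0 hu h00 huS h0S
    have hcont : ContinuousOn (fun x : ℂ => ‖x - ζ‖) S' := by fun_prop
    have hival := hS'.intermediate_value huS' h0S' hcont
    obtain ⟨x, hx, hxr⟩ := hival (show r ∈ Icc _ _ from ⟨hur.le, by
      simp only [zero_sub, norm_neg, hζ]; linarith⟩)
    refine Set.disjoint_left.mp hSK (hS'S x hx) (Or.inl (Or.inl (subset_closure ?_)))
    exact ⟨x, ⟨hS'b hx, by simpa [dist_eq_norm] using hxr⟩, rfl⟩
  refine ⟨r, hr0, ?_⟩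
  intro u hu u' hu' hur hur'
  have a := hmain u hu hur
  have b := hmain u' hu' hur'
  rw [Metric.mem_closedBall] at a b
  have := dist_triangle_right (φ u) (φ u') x1
  linarith

lemma closure_unit_ball : closure (Metric.ball (0 : ℂ) 1) = Metric.closedBall 0 1 :=
  closure_ball 0 one_ne_zero

lemma ball_or_sphere {z : ℂ} (hz : z ∈ Metric.closedBall (0 : ℂ) 1) :
    z ∈ Metric.ball (0 : ℂ) 1 ∨ z ∈ Metric.sphere (0 : ℂ) 1 := by
  rw [← Metric.ball_union_sphere] at hz
  exact hz

/-- values of the extension lie in the closure -/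
lemma ext_mem_closure (G : Set ℂ) (φ Φ : ℂ → ℂ) (hφb : Set.BijOn φ (Metric.ball 0 1) G)
    (hΦ : ContinuousOn Φ (Metric.closedBall 0 1)) (he : EqOn Φ φ (Metric.ball 0 1))
    {z : ℂ} (hz : z ∈ Metric.closedBall (0 : ℂ) 1) : Φ z ∈ closure G := by
  have h1 : Φ '' closure (Metric.ball (0 : ℂ) 1) ⊆ closure (Φ '' Metric.ball (0 : ℂ) 1) :=
    ContinuousOn.image_closure (by rwa [closure_unit_ball])
  rw [he.image_eq, hφb.image_eq, closure_unit_ball] at h1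
  exact h1 (mem_image_of_mem Φ hz)

/-- boundary points go to boundary points -/
lemma ext_mem_frontier (G : Set ℂ) (hGo : IsOpen G) (φ Φ : ℂ → ℂ)
    (hφd : DifferentiableOn ℂ φ (Metric.ball 0 1)) (hφb : Set.BijOn φ (Metric.ball 0 1) G)
    (hΦ : ContinuousOn Φ (Metric.closedBall 0 1)) (he : EqOn Φ φ (Metric.ball 0 1))
    {z : ℂ} (hz : z ∈ Metric.sphere (0 : ℂ) 1) : Φ z ∈ frontier G := by
  have hzc := Metric.sphere_subset_closedBall hz
  rw [hGo.frontier_eq]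
  refine ⟨ext_mem_closure G φ Φ hφb hΦ he hzc, fun hG => ?_⟩
  obtain ⟨g, hgc, hg1, hg2⟩ := exists_inverse G φ hφd hφb
  have hne : (𝓝[Metric.ball (0 : ℂ) 1] z).NeBot := by
    rw [← mem_closure_iff_nhdsWithin_neBot, closure_unit_ball]
    exact hzc
  have h1 : Tendsto Φ (𝓝[Metric.ball (0 : ℂ) 1] z) (𝓝 (Φ z)) :=
    (hΦ z hzc).mono_left (nhdsWithin_mono _ Metric.ball_subset_closedBall)
  have h2 : Tendsto g (𝓝 (Φ z)) (𝓝 (g (Φ z))) := hgc.continuousAt (hGo.mem_nhds hG)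
  have h3 := h2.comp h1
  have h4 : Tendsto (fun x : ℂ => x) (𝓝[Metric.ball (0 : ℂ) 1] z) (𝓝 (g (Φ z))) := by
    refine h3.congr' ?_
    filter_upwards [self_mem_nhdsWithin] with x hx
    simp only [Function.comp]
    rw [he hx, hg1 x hx]
  have h5 : Tendsto (fun x : ℂ => x) (𝓝[Metric.ball (0 : ℂ) 1] z) (𝓝 z) :=
    tendsto_id.mono_left nhdsWithin_le_nhds
  have h6 := tendsto_nhds_unique h4 h5
  have h7 := (hg2 _ hG).1
  rw [h6] at h7
  simp at h7 hz
  linarith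

lemma forward (G : Set ℂ) (hGo : IsOpen G) (φ Φ : ℂ → ℂ)
    (hφd : DifferentiableOn ℂ φ (Metric.ball 0 1)) (hφb : Set.BijOn φ (Metric.ball 0 1) G)
    (hΦ : ContinuousOn Φ (Metric.closedBall 0 1)) (he : EqOn Φ φ (Metric.ball 0 1)) :
    Φ '' Metric.sphere 0 1 = frontier G := by
  apply Subset.antisymm
  · rintro _ ⟨z, hz, rfl⟩
    exact ext_mem_frontier G hGo φ Φ hφd hφb hΦ he hz
  · intro w hw
    rw [hGo.frontier_eq] at hw
    have hc : IsClosed (Φ '' Metric.closedBall 0 1) :=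
      ((isCompact_closedBall (0 : ℂ) 1).image_of_continuousOn hΦ).isClosed
    have hsub : G ⊆ Φ '' Metric.closedBall 0 1 := by
      rw [← hφb.image_eq, ← he.image_eq]
      exact image_mono Metric.ball_subset_closedBall
    obtain ⟨z, hz, rfl⟩ := closure_minimal hsub hc hw.1
    rcases ball_or_sphere hz with h | h
    · exact absurd (by rw [he h]; exact hφb.mapsTo h) hw.2
    · exact ⟨z, h, rfl⟩

lemma exists_ext (G : Set ℂ) (hGo : IsOpen G) (hGb : Bornology.IsBounded G)
    (φ : ℂ → ℂ) (hφd : DifferentiableOn ℂ φ (Metric.ball 0 1))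
    (hφb : Set.BijOn φ (Metric.ball 0 1) G)
    (p : ℂ → ℂ) (hp : ContinuousOn p (Metric.sphere 0 1))
    (hinj : InjOn p (Metric.sphere 0 1)) (hpG : p '' Metric.sphere 0 1 = frontier G) :
    ∃ Φ : ℂ → ℂ, ContinuousOn Φ (Metric.closedBall 0 1) ∧ EqOn Φ φ (Metric.ball 0 1) := by
  refine ⟨extendFrom (Metric.ball 0 1) φ, ?_, ?_⟩
  · apply continuousOn_extendFrom
    · rw [closure_unit_ball]
    · intro z hz
      rcases ball_or_sphere hz with h | h
      · exact ⟨φ z, hφd.continuousOn z h⟩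
      · have hne : (𝓝[Metric.ball (0 : ℂ) 1] z).NeBot := by
          rw [← mem_closure_iff_nhdsWithin_neBot, closure_unit_ball]
          exact hz
        have hcau : Cauchy (map φ (𝓝[Metric.ball (0 : ℂ) 1] z)) := by
          rw [Metric.cauchy_iff]
          refine ⟨inferInstance, fun ε hε => ?_⟩
          obtain ⟨r, hr, hosc⟩ := small_osc G hGo hGb φ hφd hφb p hp hinj hpG z
            (by simpa using h) (ε / 2) (by positivity)
          refine ⟨φ '' (Metric.ball 0 1 ∩ Metric.ball z r), ?_, ?_⟩
          · apply image_mem_map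
            exact inter_mem self_mem_nhdsWithin
              (mem_nhdsWithin_of_mem_nhds (Metric.ball_mem_nhds z hr))
          · rintro _ ⟨u, hu, rfl⟩ _ ⟨v, hv, rfl⟩
            have := hosc u hu.1 v hv.1 (by simpa [dist_eq_norm] using hu.2)
              (by simpa [dist_eq_norm] using hv.2)
            linarith
        exact cauchy_map_iff_exists_tendsto.mp hcau
  · exact extendFrom_extends hφd.continuousOn

lemma sphere_minus_preconnected (c : ℂ) (hc : ‖c‖ = 1) :
    IsPreconnected (Metric.sphere (0 : ℂ) 1 \ {c}) := by
  have hc0 : c ≠ 0 := by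
    rintro rfl
    simp at hc
  have h : Metric.sphere (0 : ℂ) 1 \ {c} =
      (fun θ : ℝ => -c * Complex.exp (θ * Complex.I)) '' Ioo (-Real.pi) Real.pi := by
    ext z
    constructor
    · rintro ⟨hz, hzc⟩
      have hz1 : ‖z‖ = 1 := by simpa using hz
      have hw : ‖z / (-c)‖ = 1 := by simp [hz1, hc]
      refine ⟨Complex.arg (z / (-c)), ⟨Complex.neg_pi_lt_arg _, ?_⟩, ?_⟩
      · refine lt_of_le_of_ne (Complex.arg_le_pi _) fun h => hzc ?_
        have := Complex.norm_mul_exp_arg_mul_I (z / (-c))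
        rw [h, hw, Complex.exp_pi_mul_I] at this
        field_simp at this
        simp at this
        exact this.symm
      · have := Complex.norm_mul_exp_arg_mul_I (z / (-c))
        rw [hw] at this
        simp only
        simp only [Complex.ofReal_one, one_mul] at this
        rw [this]
        field_simp
    · rintro ⟨θ, hθ, rfl⟩
      refine ⟨by simp [hc, Complex.norm_exp_ofReal_mul_I], fun h => ?_⟩
      simp only [mem_singleton_iff] at h
      have h1 : Complex.exp (θ * Complex.I) = -1 := by
        have : c * (Complex.exp (θ * Complex.I)) = c * (-1) := by linear_combination -h
        exact mul_left_cancel₀ hc0 this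
      have h2 := Complex.arg_exp_mul_I θ
      rw [h1, Complex.arg_neg_one, (toIocMod_eq_self _).mpr] at h2
      · exact hθ.2.ne h2.symm
      · constructor
        · exact hθ.1
        · linarith [hθ.2]
  rw [h]
  exact isPreconnected_Ioo.image _ (by fun_prop)

lemma half_open_closure (h : ℂ → ℝ) (hh : Continuous h) (ξ : ℂ)
    (hξ : ξ ∈ Metric.sphere (0 : ℂ) 1) (hpos : 0 < h ξ) :
    ξ ∈ closure (Metric.ball (0 : ℂ) 1 ∩ {z | 0 < h z}) := by
  have ho : IsOpen {z | 0 < h z} := isOpen_lt continuous_const hh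
  have := ho.inter_closure (t := Metric.ball (0 : ℂ) 1)
  rw [inter_comm _ (Metric.ball (0 : ℂ) 1), closure_unit_ball] at this
  exact this ⟨hpos, Metric.sphere_subset_closedBall hξ⟩

lemma half_pre (Φ : ℂ → ℂ) (hΦ : ContinuousOn Φ (Metric.closedBall 0 1))
    (h : ℂ → ℝ) (hh : Continuous h) (hconv : Convex ℝ {z | 0 < h z}) (ξ : ℂ)
    (hξ : ξ ∈ Metric.sphere (0 : ℂ) 1) (hpos : 0 < h ξ) :
    IsPreconnected (Φ '' insert ξ (Metric.ball (0 : ℂ) 1 ∩ {z | 0 < h z})) := by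
  have h1 : IsPreconnected (Metric.ball (0 : ℂ) 1 ∩ {z | 0 < h z}) :=
    ((convex_ball (0 : ℂ) 1).inter hconv).isPreconnected
  have h2 : IsPreconnected (insert ξ (Metric.ball (0 : ℂ) 1 ∩ {z | 0 < h z})) :=
    h1.subset_closure (subset_insert _ _)
      (insert_subset (half_open_closure h hh ξ hξ hpos) subset_closure)
  refine h2.image _ (hΦ.mono ?_)
  rintro z (rfl | hz)
  · exact Metric.sphere_subset_closedBall hξ
  · exact Metric.ball_subset_closedBall hz.1

/-- A boundary-valued constancy on an open arc forces the value at the centre. -/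
lemma uniq (Φ : ℂ → ℂ) (hΦ : ContinuousOn Φ (Metric.closedBall 0 1))
    (hd : DifferentiableOn ℂ Φ (Metric.ball 0 1)) (V : Set ℂ) (hV : IsOpen V) (a ξ0 : ℂ)
    (hξ : ξ0 ∈ Metric.sphere (0 : ℂ) 1) (hξV : ξ0 ∈ V)
    (hc : ∀ z ∈ Metric.sphere (0 : ℂ) 1, z ∈ V → Φ z = a) : Φ 0 = a := by
  have hn0 : ‖ξ0‖ = 1 := by simpa using hξ
  have hU : ∀ x ∈ Metric.sphere (0 : ℂ) 1, {z | ξ0 / x * z ∈ V} ∈ 𝓝 x := by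
    intro x hx
    have hx0 : x ≠ 0 := by
      rintro rfl
      simp at hx
    have hcont : Continuous fun z : ℂ => ξ0 / x * z := by fun_prop
    apply (hV.preimage hcont).mem_nhds
    simp only [mem_preimage]
    rwa [div_mul_cancel₀ _ hx0]
  obtain ⟨t, ht, hcov⟩ := (isCompact_sphere (0 : ℂ) 1).elim_nhds_subcover _ hU
  have hrot : ∀ x ∈ t, ∀ z : ℂ, ‖ξ0 / x * z‖ = ‖z‖ := by
    intro x hx z
    have : ‖x‖ = 1 := by simpa using ht x hx
    rw [norm_mul, norm_div, hn0, this]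
    simp
  have hdc : DiffContOnCl ℂ (fun z => ∏ x ∈ t, (Φ (ξ0 / x * z) - a)) (Metric.ball 0 1) := by
    refine ⟨?_, ?_⟩
    · apply DifferentiableOn.fun_finsetProd
      intro x hx
      refine DifferentiableOn.sub_const ?_ a
      refine hd.comp (by fun_prop) fun z hz => ?_
      rw [mem_ball_zero_iff, hrot x hx]
      simpa using hz
    · rw [closure_unit_ball]
      refine continuousOn_finsetProd _ fun x hx => ?_
      refine ContinuousOn.sub ?_ continuousOn_const
      refine hΦ.comp (by fun_prop) fun z hz => ?_
      rw [mem_closedBall_zero_iff, hrot x hx]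
      simpa using hz
  have hz := Complex.eqOn_closure_of_eqOn_frontier (g := fun _ : ℂ => (0 : ℂ))
    Metric.isBounded_ball hdc diffContOnCl_const (by
      intro z hz
      rw [frontier_ball _ one_ne_zero] at hz
      have := hcov hz
      simp only [mem_iUnion] at this
      obtain ⟨x, hx, hxz⟩ := this
      apply Finset.prod_eq_zero hx
      rw [hc _ ?_ hxz, sub_self]
      rw [mem_sphere_zero_iff_norm, hrot x hx]
      simpa using hz)
  have h0 := hz (subset_closure (Metric.mem_ball_self one_pos))
  simp only [mul_zero] at h0
  obtain ⟨x, hx, h⟩ := Finset.prod_eq_zero_iff.mp h0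
  exact sub_eq_zero.mp h

/-- signed height over the chord through two points -/
noncomputable def chord (ζ1 ζ2 z : ℂ) : ℝ := ((z - ζ1) * (starRingEnd ℂ) (ζ2 - ζ1)).im

lemma chord_eq (ζ1 ζ2 z : ℂ) : chord ζ1 ζ2 z =
    (z.im - ζ1.im) * (ζ2.re - ζ1.re) - (z.re - ζ1.re) * (ζ2.im - ζ1.im) := by
  simp [chord, Complex.mul_im]
  ring

lemma chord_swap (ζ1 ζ2 z : ℂ) : chord ζ2 ζ1 z = -chord ζ1 ζ2 z := by
  rw [chord_eq, chord_eq]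
  ring

lemma chord_cont (ζ1 ζ2 : ℂ) : Continuous (chord ζ1 ζ2) := by
  unfold chord
  fun_prop

lemma chord_conv (ζ1 ζ2 : ℂ) : Convex ℝ {z | 0 < chord ζ1 ζ2 z} := by
  intro x hx y hy a b ha hb hab
  simp only [mem_ofPred_eq] at hx hy ⊢
  have : chord ζ1 ζ2 (a • x + b • y) = a * chord ζ1 ζ2 x + b * chord ζ1 ζ2 y := by
    have hb' : b = 1 - a := by linarith
    subst hb'
    simp only [chord_eq, Complex.add_im, Complex.add_re, Complex.real_smul, Complex.mul_re,
      Complex.mul_im, Complex.ofReal_re, Complex.ofReal_im]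
    ring
  rw [this]
  rcases ha.eq_or_lt with h | h
  · have : b = 1 := by linarith
    rw [← h, this]
    linarith
  · have := mul_pos h hx
    have := mul_nonneg hb hy.le
    linarith

lemma chord_zero {ζ1 ζ2 z : ℂ} (h1 : ‖ζ1‖ = 1) (h2 : ‖ζ2‖ = 1) (hz : ‖z‖ = 1)
    (hne : ζ1 ≠ ζ2) (h : chord ζ1 ζ2 z = 0) : z = ζ1 ∨ z = ζ2 := by
  have hE := Complex.conj_eq_iff_im.mpr h
  have n1 : ζ1 ≠ 0 := norm_ne_zero_iff.mp (by rw [h1]; exact one_ne_zero)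
  have n2 : ζ2 ≠ 0 := norm_ne_zero_iff.mp (by rw [h2]; exact one_ne_zero)
  have nz : z ≠ 0 := norm_ne_zero_iff.mp (by rw [hz]; exact one_ne_zero)
  simp only [map_mul, map_sub, Complex.conj_conj] at hE
  rw [← Complex.inv_eq_conj h1, ← Complex.inv_eq_conj h2, ← Complex.inv_eq_conj hz] at hE
  field_simp at hE
  have : (z - ζ1) * ((ζ1 - ζ2) * (z - ζ2)) = 0 := by linear_combination (-1) * hE
  rcases mul_eq_zero.mp this with h | h
  · exact Or.inl (sub_eq_zero.mp h)
  · rcases mul_eq_zero.mp h with h | h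
    · exact absurd (sub_eq_zero.mp h) hne
    · exact Or.inr (sub_eq_zero.mp h)

lemma chord_point {ζ1 ζ2 : ℂ} (h1 : ‖ζ1‖ = 1) (h2 : ‖ζ2‖ = 1) (hne : ζ1 ≠ ζ2) :
    ∃ ξ ∈ Metric.sphere (0 : ℂ) 1, 0 < chord ζ1 ζ2 ξ := by
  have hd : 0 < ‖ζ2 - ζ1‖ := norm_pos_iff.mpr (sub_ne_zero.mpr hne.symm)
  have e1 : ζ1.re * ζ1.re + ζ1.im * ζ1.im = 1 := by
    rw [← Complex.normSq_apply, Complex.normSq_eq_norm_sq, h1]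
    norm_num
  have e2 : ζ2.re * ζ2.re + ζ2.im * ζ2.im = 1 := by
    rw [← Complex.normSq_apply, Complex.normSq_eq_norm_sq, h2]
    norm_num
  have e3 : (ζ2.re - ζ1.re) * (ζ2.re - ζ1.re) + (ζ2.im - ζ1.im) * (ζ2.im - ζ1.im) =
      ‖ζ2 - ζ1‖ ^ 2 := by
    rw [← Complex.normSq_eq_norm_sq, Complex.normSq_apply]
    simp
  set n := ‖ζ2 - ζ1‖ with hn
  refine ⟨Complex.I * (ζ2 - ζ1) / n, ?_, ?_⟩
  · rw [mem_sphere_zero_iff_norm, norm_div, norm_mul, Complex.norm_I, Complex.norm_real,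
      ← hn, Real.norm_of_nonneg hd.le, one_mul, div_self hd.ne']
  · have hq : chord ζ1 ζ2 (Complex.I * (ζ2 - ζ1) / n) =
        n - (ζ1.im * (ζ2.re - ζ1.re) - ζ1.re * (ζ2.im - ζ1.im)) := by
      rw [chord_eq]
      simp only [Complex.div_ofReal_re, Complex.div_ofReal_im, Complex.mul_re, Complex.mul_im,
        Complex.I_re, Complex.I_im, Complex.sub_re, Complex.sub_im]
      field_simp
      linear_combination e3
    rw [hq]
    set m := ζ1.im * (ζ2.re - ζ1.re) - ζ1.re * (ζ2.im - ζ1.im) with hm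
    have hr : (ζ1.re * (ζ2.re - ζ1.re) + ζ1.im * (ζ2.im - ζ1.im)) = -(n ^ 2) / 2 := by
      linear_combination (1 / 2) * e2 - (1 / 2) * e1 - (1 / 2) * e3
    have hs : m ^ 2 + (n ^ 2 / 2) ^ 2 = n ^ 2 := by
      have : m ^ 2 + (ζ1.re * (ζ2.re - ζ1.re) + ζ1.im * (ζ2.im - ζ1.im)) ^ 2 = n ^ 2 := by
        rw [hm]
        linear_combination e3 + ((ζ2.re - ζ1.re) ^ 2 + (ζ2.im - ζ1.im) ^ 2) * e1
      rw [hr] at this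
      linear_combination this
    have : 0 < (n ^ 2 / 2) ^ 2 := by positivity
    have : m < n := by
      apply lt_of_pow_lt_pow_left₀ 2 hd.le
      linarith
    linarith

lemma half_const (G : Set ℂ) (hGo : IsOpen G) (hGb : Bornology.IsBounded G)
    (hGc : IsConnected G)
    (φ Φ : ℂ → ℂ) (hφd : DifferentiableOn ℂ φ (Metric.ball 0 1))
    (hφb : Set.BijOn φ (Metric.ball 0 1) G)
    (p : ℂ → ℂ) (hp : ContinuousOn p (Metric.sphere 0 1))
    (hinj : InjOn p (Metric.sphere 0 1)) (hpG : p '' Metric.sphere 0 1 = frontier G)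
    (hΦ : ContinuousOn Φ (Metric.closedBall 0 1)) (he : EqOn Φ φ (Metric.ball 0 1))
    (ζ1 ζ2 : ℂ) (h1 : ‖ζ1‖ = 1) (h2 : ‖ζ2‖ = 1) (hne : ζ1 ≠ ζ2) (heq : Φ ζ1 = Φ ζ2)
    (ξ1 ξ2 : ℂ) (hξ1 : ξ1 ∈ Metric.sphere (0 : ℂ) 1) (hξ2 : ξ2 ∈ Metric.sphere (0 : ℂ) 1)
    (hp1 : 0 < chord ζ1 ζ2 ξ1) (hp2 : 0 < chord ζ2 ζ1 ξ2)
    (hv1 : Φ ξ1 ≠ Φ ζ1) (hv2 : Φ ξ2 ≠ Φ ζ1) : False := by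
  have hfr : ∀ {z : ℂ}, z ∈ Metric.sphere (0 : ℂ) 1 → Φ z ∈ frontier G := fun hz =>
    ext_mem_frontier G hGo φ Φ hφd hφb hΦ he hz
  have hin : ∀ {z : ℂ}, z ∈ Metric.ball (0 : ℂ) 1 → Φ z ∈ G := fun hz => by
    rw [he hz]
    exact hφb.mapsTo hz
  have hdisj : ∀ {w : ℂ}, w ∈ G → w ∉ frontier G := fun hw hf => by
    rw [hGo.frontier_eq] at hf
    exact hf.2 hw
  set a := Φ ζ1 with ha
  have haf : a ∈ frontier G := hfr (by simpa using h1)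
  set Q := Metric.closedBall (0 : ℂ) 1 ∩ {z | chord ζ1 ζ2 z = 0} with hQ
  have hQc : IsCompact Q := (isCompact_closedBall (0 : ℂ) 1).inter_right
    (isClosed_eq (chord_cont _ _) continuous_const)
  have hJ : IsCompact (Φ '' Q) := hQc.image_of_continuousOn (hΦ.mono inter_subset_left)
  have hF : IsCompact (frontier G) := by
    rw [← hpG]
    exact (isCompact_sphere (0 : ℂ) 1).image_of_continuousOn hp
  have hQs : ∀ z ∈ Q, z ∈ Metric.sphere (0 : ℂ) 1 → Φ z = a := by
    intro z hz hzs
    rcases chord_zero h1 h2 (by simpa using hzs) hne hz.2 with rfl | rfl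
    · rfl
    · exact heq.symm
  have hJF : Φ '' Q ∩ frontier G = {a} := by
    apply Subset.antisymm
    · rintro _ ⟨⟨z, hz, rfl⟩, hf⟩
      rcases ball_or_sphere hz.1 with h | h
      · exact absurd hf (hdisj (hin h))
      · exact hQs z hz h
    · rintro _ rfl
      refine ⟨⟨ζ1, ⟨by simp [h1], ?_⟩, rfl⟩, haf⟩
      simp [chord]
  -- the two interior points
  obtain ⟨u1, hu1b, hu1⟩ : (Metric.ball (0 : ℂ) 1 ∩ {z | 0 < chord ζ1 ζ2 z}).Nonempty :=
    closure_nonempty_iff.mp ⟨ξ1, half_open_closure _ (chord_cont _ _) _ hξ1 hp1⟩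
  obtain ⟨u2, hu2b, hu2⟩ : (Metric.ball (0 : ℂ) 1 ∩ {z | 0 < chord ζ2 ζ1 z}).Nonempty :=
    closure_nonempty_iff.mp ⟨ξ2, half_open_closure _ (chord_cont _ _) _ hξ2 hp2⟩
  have hS1 := half_pre Φ hΦ _ (chord_cont ζ1 ζ2) (chord_conv _ _) ξ1 hξ1 hp1
  have hS2 := half_pre Φ hΦ _ (chord_cont ζ2 ζ1) (chord_conv _ _) ξ2 hξ2 hp2
  have hFa : IsPreconnected (frontier G \ {a}) := by
    rw [← hpG] at haf ⊢
    obtain ⟨c, hc, hca⟩ := haf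
    have : p '' Metric.sphere 0 1 \ {a} = p '' (Metric.sphere 0 1 \ {c}) := by
      ext w
      constructor
      · rintro ⟨⟨z, hz, rfl⟩, hw⟩
        refine ⟨z, ⟨hz, ?_⟩, rfl⟩
        rintro rfl
        exact hw hca
      · rintro ⟨z, ⟨hz, hzc⟩, rfl⟩
        refine ⟨⟨z, hz, rfl⟩, fun h => hzc ?_⟩
        exact hinj hz hc (h.trans hca.symm)
    rw [this]
    exact (sphere_minus_preconnected c (by simpa using hc)).image p (hp.mono sdiff_subset)
  have hval : ∀ z ∈ Metric.ball (0 : ℂ) 1, chord ζ1 ζ2 z ≠ 0 → Φ z ∉ Φ '' Q := by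
    rintro z hz hne0 ⟨w, hw, hwz⟩
    rcases ball_or_sphere hw.1 with h | h
    · have : w = z := hφb.injOn h hz (by rw [← he h, ← he hz, hwz])
      rw [← this] at hne0
      exact hne0 hw.2
    · have := hfr h
      rw [hwz] at this
      exact hdisj (hin hz) this
  have hbd : ∀ w ∈ frontier G, w ≠ a → w ∉ Φ '' Q := by
    intro w hw hwa hwQ
    have : w ∈ Φ '' Q ∩ frontier G := ⟨hwQ, hw⟩
    rw [hJF] at this
    exact hwa this
  obtain ⟨S3, hS3, hd3, hm1, hm2⟩ := janiszewski (p := Φ u1) (q := Φ u2) hJ hF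
    (by rw [hJF]; exact isPreconnected_singleton)
    ⟨Φ '' insert ξ1 (Metric.ball (0 : ℂ) 1 ∩ {z | 0 < chord ζ1 ζ2 z}) ∪ (frontier G \ {a}) ∪
      Φ '' insert ξ2 (Metric.ball (0 : ℂ) 1 ∩ {z | 0 < chord ζ2 ζ1 z}), by
        refine IsPreconnected.union (Φ ξ2) (Or.inr ⟨hfr hξ2, hv2⟩)
          ⟨ξ2, mem_insert _ _, rfl⟩ ?_ hS2
        exact IsPreconnected.union (Φ ξ1) ⟨ξ1, mem_insert _ _, rfl⟩ ⟨hfr hξ1, hv1⟩ hS1 hFa, by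
        rw [Set.disjoint_left]
        rintro _ ((⟨z, (rfl | hz), rfl⟩ | ⟨hw, hwa⟩) | ⟨z, (rfl | hz), rfl⟩)
        · exact hbd _ (hfr hξ1) hv1
        · exact hval z hz.1 hz.2.ne'
        · exact hbd _ hw hwa
        · exact hbd _ (hfr hξ2) hv2
        · refine hval z hz.1 fun h => ?_
          have h3 := hz.2
          simp only [mem_ofPred_eq, chord_swap ζ1 ζ2, h] at h3
          simp at h3,
      Or.inl (Or.inl ⟨u1, Or.inr ⟨hu1b, hu1⟩, rfl⟩), Or.inr ⟨u2, Or.inr ⟨hu2b, hu2⟩, rfl⟩⟩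
    ⟨G, hGc.isPreconnected, Set.disjoint_left.mpr fun _ hw => hdisj hw, hin hu1b, hin hu2b⟩
  rw [he hu1b] at hm1
  rw [he hu2b] at hm2
  obtain ⟨S, hS, hSb, hSu, hSv, hSm⟩ := pull_back G hGo φ hφd hφb S3 hS3
    (hd3.mono_right subset_union_right) u1 u2 hu1b hu2b hm1 hm2
  have hiv := hS.intermediate_value hSv hSu (chord_cont ζ1 ζ2).continuousOn
  simp only [mem_ofPred_eq, chord_swap ζ1 ζ2] at hu1 hu2
  obtain ⟨z, hzS, hz0⟩ := hiv (show (0 : ℝ) ∈ Icc _ _ from ⟨by linarith, hu1.le⟩)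
  have hzb := hSb hzS
  refine Set.disjoint_left.mp hd3 (hSm z hzS) (Or.inl ⟨z, ⟨Metric.ball_subset_closedBall hzb, hz0⟩,
    he hzb⟩)

lemma ext_inj (G : Set ℂ) (hGo : IsOpen G) (hGb : Bornology.IsBounded G)
    (hGc : IsConnected G)
    (φ Φ : ℂ → ℂ) (hφd : DifferentiableOn ℂ φ (Metric.ball 0 1))
    (hφb : Set.BijOn φ (Metric.ball 0 1) G)
    (p : ℂ → ℂ) (hp : ContinuousOn p (Metric.sphere 0 1))
    (hinj : InjOn p (Metric.sphere 0 1)) (hpG : p '' Metric.sphere 0 1 = frontier G)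
    (hΦ : ContinuousOn Φ (Metric.closedBall 0 1)) (he : EqOn Φ φ (Metric.ball 0 1)) :
    InjOn Φ (Metric.closedBall 0 1) := by
  have hfr : ∀ {z : ℂ}, z ∈ Metric.sphere (0 : ℂ) 1 → Φ z ∈ frontier G := fun hz =>
    ext_mem_frontier G hGo φ Φ hφd hφb hΦ he hz
  have hin : ∀ {z : ℂ}, z ∈ Metric.ball (0 : ℂ) 1 → Φ z ∈ G := fun hz => by
    rw [he hz]
    exact hφb.mapsTo hz
  have hdisj : ∀ {w : ℂ}, w ∈ G → w ∉ frontier G := fun hw hf => by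
    rw [hGo.frontier_eq] at hf
    exact hf.2 hw
  have hcst : ∀ ζ1 ζ2 : ℂ, ‖ζ1‖ = 1 → ‖ζ2‖ = 1 → ζ1 ≠ ζ2 → ∀ a ∈ frontier G,
      ¬ ∀ z ∈ Metric.sphere (0 : ℂ) 1, 0 < chord ζ1 ζ2 z → Φ z = a := by
    intro ζ1 ζ2 h1 h2 hne a ha hall
    obtain ⟨ξ, hξ, hpos⟩ := chord_point h1 h2 hne
    have h0 := uniq Φ hΦ (hφd.congr he) {z | 0 < chord ζ1 ζ2 z}
      (isOpen_lt continuous_const (chord_cont _ _)) a ξ hξ hpos hall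
    have h0b := hin (z := 0) (by simp)
    rw [h0] at h0b
    exact hdisj h0b ha
  intro x hx y hy hxy
  rcases ball_or_sphere hx with hxb | hxs <;> rcases ball_or_sphere hy with hyb | hys
  · exact hφb.injOn hxb hyb (by rw [← he hxb, ← he hyb, hxy])
  · exact absurd (hxy ▸ hfr hys) (hdisj (hin hxb))
  · exact absurd (hxy ▸ hfr hxs) (hdisj (hin hyb))
  · by_contra hne
    have h1 : ‖x‖ = 1 := by simpa using hxs
    have h2 : ‖y‖ = 1 := by simpa using hys
    have c1 := hcst x y h1 h2 hne _ (hfr hxs)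
    have c2 := hcst y x h2 h1 (Ne.symm hne) _ (hfr hxs)
    push Not at c1 c2
    obtain ⟨ξ1, hξ1, hp1, hv1⟩ := c1
    obtain ⟨ξ2, hξ2, hp2, hv2⟩ := c2
    exact half_const G hGo hGb hGc φ Φ hφd hφb p hp hinj hpG hΦ he x y h1 h2 hne hxy
      ξ1 ξ2 hξ1 hξ2 hp1 hp2 hv1 hv2

end CaraProof

/-- A conformal map `φ` from the open unit disc onto a bounded simply connected
domain `G` has a continuous and injective extension to the closed disc if and
only if `∂G` is a Jordan curve. -/
theorem caratheodory_injective_extension_iff_jordan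
    (G : Set ℂ) (hGo : IsOpen G) (hGb : Bornology.IsBounded G)
    (hGc : IsConnected G) (hGs : SimplyConnectedSpace G)
    (φ : ℂ → ℂ) (hφd : DifferentiableOn ℂ φ (Metric.ball 0 1))
    (hφb : Set.BijOn φ (Metric.ball 0 1) G) :
    (∃ Φ : ℂ → ℂ, ContinuousOn Φ (Metric.closedBall 0 1) ∧
      Set.InjOn Φ (Metric.closedBall 0 1) ∧ Set.EqOn Φ φ (Metric.ball 0 1)) ↔
    (∃ p : ℂ → ℂ, ContinuousOn p (Metric.sphere 0 1) ∧
      Set.InjOn p (Metric.sphere 0 1) ∧ p '' Metric.sphere 0 1 = frontier G) := by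
  constructor
  · rintro ⟨Φ, hΦ, hi, he⟩
    exact ⟨Φ, hΦ.mono Metric.sphere_subset_closedBall, hi.mono Metric.sphere_subset_closedBall,
      CaraProof.forward G hGo φ Φ hφd hφb hΦ he⟩
  · rintro ⟨p, hp, hinj, hpG⟩
    obtain ⟨Φ, hΦ, he⟩ := CaraProof.exists_ext G hGo hGb φ hφd hφb p hp hinj hpG
    exact ⟨Φ, hΦ, CaraProof.ext_inj G hGo hGb hGc φ Φ hφd hφb p hp hinj hpG hΦ he, he⟩
end
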